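/- arXiv:math/0507478 — 2 statements merged into one kernel-verified Lean document; each statement's English description precedes it below -/
import Mathlib

section
/- The algebra U_q(g) is isomorphic to the equitable algebra U: there is an isomorphism of 𝕂(q)-algebras θ: U → U_q(g) satisfying θ(X_i^{±1}) = K_i^{±1}, θ(Y_i) = K_i^{-1} + F_i(q_i - q_i^{-1}), θ(Z_i) = K_i^{-1} - K_i^{-1}E_i q_i(q_i - q_i^{-1}) for 1 ≤ i ≤ n, and its inverse satisfies θ^{-1}(E_i) = (1 - X_iZ_i)q_i^{-1}(q_i - q_i^{-1})^{-1}, θ^{-1}(F_i) = (Y_i - X_i^{-1})(q_i - q_i^{-1})^{-1}, θ^{-1}(K_i^{±1}) = X_i^{±1}. -/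
open FreeAlgebra
open scoped TensorProduct

noncomputable section

/-- The field `𝕂(q)` of rational functions in the indeterminate `q` over `𝕂`. -/
abbrev Kq (K : Type) [Field K] : Type := RatFunc K

/-- The indeterminate `q` viewed as an element of `𝕂(q)`. -/
def qv (K : Type) [Field K] : Kq K := RatFunc.X

/-- `q_i = q^{d_i}`, given the exponent `di = d_i`. -/
def qi (K : Type) [Field K] (di : ℕ) : Kq K := qv K ^ di

/-- The quantum integer `[m]_i = (q_i^m - q_i^{-m})/(q_i - q_i⁻¹)`. -/
def qnum (K : Type) [Field K] (di : ℕ) (m : ℤ) : Kq K :=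
  (qi K di ^ m - qi K di ^ (-m)) / (qi K di - (qi K di)⁻¹)

/-- The quantum factorial `[m]_i! = [m]_i [m-1]_i ⋯ [1]_i`, with `[0]_i! = 1`. -/
def qfac (K : Type) [Field K] (di : ℕ) : ℕ → Kq K
  | 0 => 1
  | m + 1 => qnum K di (m + 1) * qfac K di m

/-- The Gaussian binomial coefficient `[m choose r]_i = [m]_i!/([r]_i![m-r]_i!)`. -/
def qbin (K : Type) [Field K] (di m r : ℕ) : Kq K :=
  qfac K di m / (qfac K di r * qfac K di (m - r))

/-- Chevalley generators `E_i, F_i, K_i, K_i⁻¹` of `U_q(g)`. -/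
inductive CGen (n : ℕ) : Type
  | E : Fin n → CGen n
  | F : Fin n → CGen n
  | K : Fin n → CGen n
  | Kinv : Fin n → CGen n

/-- The defining relations (R1)–(R7) of `U_q(g)` in the Chevalley presentation. -/
inductive CRel (K : Type) [Field K] {n : ℕ} (A : Matrix (Fin n) (Fin n) ℤ) (d : Fin n → ℕ) :
    FreeAlgebra (Kq K) (CGen n) → FreeAlgebra (Kq K) (CGen n) → Prop
  | R1a (i : Fin n) : CRel K A d (ι (Kq K) (CGen.K i) * ι (Kq K) (CGen.Kinv i)) 1
  | R1b (i : Fin n) : CRel K A d (ι (Kq K) (CGen.Kinv i) * ι (Kq K) (CGen.K i)) 1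
  | R2 (i j : Fin n) : CRel K A d (ι (Kq K) (CGen.K i) * ι (Kq K) (CGen.K j))
      (ι (Kq K) (CGen.K j) * ι (Kq K) (CGen.K i))
  | R3 (i j : Fin n) : CRel K A d
      (ι (Kq K) (CGen.K i) * ι (Kq K) (CGen.E j) * ι (Kq K) (CGen.Kinv i))
      (qi K (d i) ^ (A i j) • ι (Kq K) (CGen.E j))
  | R4 (i j : Fin n) : CRel K A d
      (ι (Kq K) (CGen.K i) * ι (Kq K) (CGen.F j) * ι (Kq K) (CGen.Kinv i))
      (qi K (d i) ^ (-(A i j)) • ι (Kq K) (CGen.F j))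
  | R5 (i j : Fin n) : CRel K A d
      (ι (Kq K) (CGen.E i) * ι (Kq K) (CGen.F j) - ι (Kq K) (CGen.F j) * ι (Kq K) (CGen.E i))
      (if i = j then (qi K (d i) - (qi K (d i))⁻¹)⁻¹ •
        (ι (Kq K) (CGen.K i) - ι (Kq K) (CGen.Kinv i)) else 0)
  | R6 (i j : Fin n) (hij : i ≠ j) : CRel K A d
      (∑ r ∈ Finset.range ((1 - A i j).toNat + 1),
        ((-1 : Kq K) ^ r * qbin K (d i) (1 - A i j).toNat r) •
          (ι (Kq K) (CGen.E i) ^ ((1 - A i j).toNat - r) * ι (Kq K) (CGen.E j) *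
            ι (Kq K) (CGen.E i) ^ r)) 0
  | R7 (i j : Fin n) (hij : i ≠ j) : CRel K A d
      (∑ r ∈ Finset.range ((1 - A i j).toNat + 1),
        ((-1 : Kq K) ^ r * qbin K (d i) (1 - A i j).toNat r) •
          (ι (Kq K) (CGen.F i) ^ ((1 - A i j).toNat - r) * ι (Kq K) (CGen.F j) *
            ι (Kq K) (CGen.F i) ^ r)) 0

/-- The quantum group `U_q(g)` presented by generators and relations (R1)–(R7). -/
abbrev Uqg (K : Type) [Field K] {n : ℕ} (A : Matrix (Fin n) (Fin n) ℤ) (d : Fin n → ℕ) :=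
  RingQuot (CRel K A d)

variable (K : Type) [Field K] {n : ℕ} (A : Matrix (Fin n) (Fin n) ℤ) (d : Fin n → ℕ)

def genE (i : Fin n) : Uqg K A d := RingQuot.mkAlgHom (Kq K) (CRel K A d) (ι (Kq K) (CGen.E i))
def genF (i : Fin n) : Uqg K A d := RingQuot.mkAlgHom (Kq K) (CRel K A d) (ι (Kq K) (CGen.F i))
def genK (i : Fin n) : Uqg K A d := RingQuot.mkAlgHom (Kq K) (CRel K A d) (ι (Kq K) (CGen.K i))
def genKinv (i : Fin n) : Uqg K A d :=
  RingQuot.mkAlgHom (Kq K) (CRel K A d) (ι (Kq K) (CGen.Kinv i))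

/-- Equitable generators `X_i, X_i⁻¹, Y_i, Z_i`. -/
inductive EGen (n : ℕ) : Type
  | X : Fin n → EGen n
  | Xinv : Fin n → EGen n
  | Y : Fin n → EGen n
  | Z : Fin n → EGen n

/-- The defining relations (E1)–(E8) of the equitable presentation. -/
inductive ERel (K : Type) [Field K] {n : ℕ} (A : Matrix (Fin n) (Fin n) ℤ) (d : Fin n → ℕ) :
    FreeAlgebra (Kq K) (EGen n) → FreeAlgebra (Kq K) (EGen n) → Prop
  | E1a (i : Fin n) : ERel K A d (ι (Kq K) (EGen.X i) * ι (Kq K) (EGen.Xinv i)) 1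
  | E1b (i : Fin n) : ERel K A d (ι (Kq K) (EGen.Xinv i) * ι (Kq K) (EGen.X i)) 1
  | E2 (i j : Fin n) : ERel K A d (ι (Kq K) (EGen.X i) * ι (Kq K) (EGen.X j))
      (ι (Kq K) (EGen.X j) * ι (Kq K) (EGen.X i))
  | E3 (i j : Fin n) : ERel K A d
      (ι (Kq K) (EGen.Y i) * ι (Kq K) (EGen.X j) -
        qi K (d i) ^ (A i j) • (ι (Kq K) (EGen.X j) * ι (Kq K) (EGen.Y i)))
      ((1 - qi K (d i) ^ (A i j)) • (ι (Kq K) (EGen.Xinv i) * ι (Kq K) (EGen.X j)))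
  | E4 (i j : Fin n) : ERel K A d
      (ι (Kq K) (EGen.X i) * ι (Kq K) (EGen.Z j) -
        qi K (d i) ^ (A i j) • (ι (Kq K) (EGen.Z j) * ι (Kq K) (EGen.X i)))
      ((1 - qi K (d i) ^ (A i j)) • (ι (Kq K) (EGen.X i) * ι (Kq K) (EGen.Xinv j)))
  | E5 (i : Fin n) : ERel K A d
      (ι (Kq K) (EGen.Z i) * ι (Kq K) (EGen.Y i) -
        (qi K (d i) ^ 2) • (ι (Kq K) (EGen.Y i) * ι (Kq K) (EGen.Z i)))
      ((1 - qi K (d i) ^ 2) • 1)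
  | E6 (i j : Fin n) (hij : i ≠ j) : ERel K A d
      (ι (Kq K) (EGen.Z i) * ι (Kq K) (EGen.Y j) -
        qi K (d i) ^ (A i j) • (ι (Kq K) (EGen.Y j) * ι (Kq K) (EGen.Z i)))
      ((1 - qi K (d i) ^ (A i j)) • (ι (Kq K) (EGen.Xinv i) * ι (Kq K) (EGen.Xinv j)))
  | E7 (i j : Fin n) (hij : i ≠ j) : ERel K A d
      (∑ r ∈ Finset.range ((1 - A i j).toNat + 1),
        ((-1 : Kq K) ^ r * qbin K (d i) (1 - A i j).toNat r) •
          (ι (Kq K) (EGen.Y i) ^ ((1 - A i j).toNat - r) * ι (Kq K) (EGen.Y j) *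
            ι (Kq K) (EGen.Y i) ^ r))
      ((∏ s ∈ Finset.range ((-(A i j)).toNat + 1), (1 - qi K (d i) ^ (A i j + 2 * (s : ℤ)))) •
        (ι (Kq K) (EGen.Xinv i) ^ (1 - A i j).toNat * ι (Kq K) (EGen.Xinv j)))
  | E8 (i j : Fin n) (hij : i ≠ j) : ERel K A d
      (∑ r ∈ Finset.range ((1 - A i j).toNat + 1),
        ((-1 : Kq K) ^ r * qbin K (d i) (1 - A i j).toNat r) •
          (ι (Kq K) (EGen.Z i) ^ ((1 - A i j).toNat - r) * ι (Kq K) (EGen.Z j) *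
            ι (Kq K) (EGen.Z i) ^ r))
      ((∏ s ∈ Finset.range ((-(A i j)).toNat + 1), (1 - qi K (d i) ^ (A i j + 2 * (s : ℤ)))) •
        (ι (Kq K) (EGen.Xinv i) ^ (1 - A i j).toNat * ι (Kq K) (EGen.Xinv j)))

/-- The equitable algebra `U` presented by generators and relations (E1)–(E8). -/
abbrev Ueqg (K : Type) [Field K] {n : ℕ} (A : Matrix (Fin n) (Fin n) ℤ) (d : Fin n → ℕ) :=
  RingQuot (ERel K A d)

def genX (i : Fin n) : Ueqg K A d := RingQuot.mkAlgHom (Kq K) (ERel K A d) (ι (Kq K) (EGen.X i))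
def genXinv (i : Fin n) : Ueqg K A d :=
  RingQuot.mkAlgHom (Kq K) (ERel K A d) (ι (Kq K) (EGen.Xinv i))
def genY (i : Fin n) : Ueqg K A d := RingQuot.mkAlgHom (Kq K) (ERel K A d) (ι (Kq K) (EGen.Y i))
def genZ (i : Fin n) : Ueqg K A d := RingQuot.mkAlgHom (Kq K) (ERel K A d) (ι (Kq K) (EGen.Z i))

/-- `A` is a symmetrizable generalized Cartan matrix with symmetrizing positive,
relatively prime integers `d_i`, and `n ≥ 1`. -/
def IsSymmetrizableGCM {n : ℕ} (A : Matrix (Fin n) (Fin n) ℤ) (d : Fin n → ℕ) : Prop :=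
  0 < n ∧ (∀ i, A i i = 2) ∧ (∀ i j, i ≠ j → A i j ≤ 0) ∧
    (∀ i, 0 < d i) ∧ Finset.univ.gcd d = 1 ∧
    (∀ i j, (d i : ℤ) * A i j = (d j : ℤ) * A j i)

end

section QuantumSerre

variable {F B : Type*} [Field F] [Ring B] [Algebra F B]

/-- The quantum integer at a parameter `Q`. -/
def quantumInt (Q : F) (m : ℤ) : F := (Q ^ m - Q ^ (-m)) / (Q - Q⁻¹)

/-- The quantum factorial at a parameter `Q`. -/
def quantumFactorial (Q : F) : ℕ → F
  | 0 => 1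
  | m + 1 => quantumInt Q (m + 1) * quantumFactorial Q m

/-- The Gaussian binomial coefficient at a parameter `Q`. -/
def gaussBinom (Q : F) (m r : ℕ) : F :=
  quantumFactorial Q m / (quantumFactorial Q r * quantumFactorial Q (m - r))

theorem quantumInt_inv (Q : F) (m : ℤ) : quantumInt Q⁻¹ m = quantumInt Q m := by
  simp only [quantumInt, inv_zpow', neg_neg, inv_inv]
  rw [← neg_sub (Q ^ m), ← neg_sub Q, neg_div_neg_eq]

theorem quantumFactorial_inv (Q : F) (m : ℕ) : quantumFactorial Q⁻¹ m = quantumFactorial Q m := by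
  induction m with
  | zero => rfl
  | succ m ih => simp only [quantumFactorial, quantumInt_inv, ih]

theorem gaussBinom_inv (Q : F) (m r : ℕ) : gaussBinom Q⁻¹ m r = gaussBinom Q m r := by
  simp only [gaussBinom, quantumFactorial_inv]

theorem sub_inv_ne_zero_of_pow_ne_one {Q : F} (hQ : Q ≠ 0) (h : ∀ m : ℕ, 0 < m → Q ^ m ≠ 1) :
    Q - Q⁻¹ ≠ 0 := by
  intro h0
  apply h 2 two_pos
  rw [sub_eq_zero] at h0
  rw [pow_two]
  nth_rewrite 1 [h0]
  exact inv_mul_cancel₀ hQ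

theorem quantumInt_ne_zero {Q : F} (hQ : Q ≠ 0) (h : ∀ m : ℕ, 0 < m → Q ^ m ≠ 1) (m : ℕ) :
    quantumInt Q (m + 1) ≠ 0 := by
  refine div_ne_zero (fun h0 => ?_) (sub_inv_ne_zero_of_pow_ne_one hQ h)
  apply h (2 * (m + 1)) (by positivity)
  rw [sub_eq_zero] at h0
  have h1 : Q ^ ((m : ℤ) + 1) * Q ^ ((m : ℤ) + 1) = 1 := by
    nth_rewrite 1 [h0]
    rw [← zpow_add₀ hQ]
    simp
  rw [two_mul, pow_add]
  exact_mod_cast h1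

theorem quantumFactorial_ne_zero {Q : F} (hQ : Q ≠ 0) (h : ∀ m : ℕ, 0 < m → Q ^ m ≠ 1) (m : ℕ) :
    quantumFactorial Q m ≠ 0 := by
  induction m with
  | zero => exact one_ne_zero
  | succ m ih => exact mul_ne_zero (quantumInt_ne_zero hQ h m) ih

theorem quantumInt_add {Q : F} (hQ : Q ≠ 0) (a b : ℤ) :
    quantumInt Q (a + b) = Q ^ (-a) * quantumInt Q b + Q ^ b * quantumInt Q a := by
  simp only [quantumInt, neg_add, zpow_add₀ hQ]
  ring

theorem gaussBinom_zero_right {Q : F} (hQ : Q ≠ 0) (h : ∀ m : ℕ, 0 < m → Q ^ m ≠ 1) (m : ℕ) :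
    gaussBinom Q m 0 = 1 := by
  simp [gaussBinom, quantumFactorial, quantumFactorial_ne_zero hQ h]

theorem gaussBinom_self {Q : F} (hQ : Q ≠ 0) (h : ∀ m : ℕ, 0 < m → Q ^ m ≠ 1) (m : ℕ) :
    gaussBinom Q m m = 1 := by
  simp [gaussBinom, quantumFactorial, quantumFactorial_ne_zero hQ h]

/-- The Pascal recursion for Gaussian binomial coefficients. -/
theorem gaussBinom_succ_succ {Q : F} (hQ : Q ≠ 0) (h : ∀ m : ℕ, 0 < m → Q ^ m ≠ 1) {m r : ℕ}
    (hr : r < m) :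
    gaussBinom Q (m + 1) (r + 1) =
      Q ^ (-((r : ℤ) + 1)) * gaussBinom Q m (r + 1) + Q ^ ((m : ℤ) - r) * gaussBinom Q m r := by
  obtain ⟨s, rfl⟩ := Nat.exists_eq_add_of_lt hr
  have e1 : r + s + 1 + 1 - (r + 1) = s + 1 := by omega
  have e2 : r + s + 1 - (r + 1) = s := by omega
  have e3 : r + s + 1 - r = s + 1 := by omega
  have e4 : (((r + s + 1 : ℕ) : ℤ) - r) = s + 1 := by push_cast; ring
  have e5 : (((r + s + 1 : ℕ) : ℤ) + 1) = (r + 1) + (s + 1) := by push_cast; ring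
  have h1 := quantumFactorial_ne_zero hQ h r
  have h2 := quantumFactorial_ne_zero hQ h s
  have h3 := quantumInt_ne_zero hQ h r
  have h4 := quantumInt_ne_zero hQ h s
  have key : quantumFactorial Q (r + s + 1 + 1) =
      (Q ^ (-((r : ℤ) + 1)) * quantumInt Q (s + 1) + Q ^ ((s : ℤ) + 1) * quantumInt Q (r + 1)) *
        quantumFactorial Q (r + s + 1) := by
    rw [quantumFactorial, e5, quantumInt_add hQ]
  have hr1 : quantumFactorial Q (r + 1) = quantumInt Q (r + 1) * quantumFactorial Q r := rfl
  have hs1 : quantumFactorial Q (s + 1) = quantumInt Q (s + 1) * quantumFactorial Q s := rfl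
  simp only [gaussBinom, e1, e2, e3, e4, key, hr1, hs1]
  generalize Q ^ (-((r : ℤ) + 1)) = α
  generalize Q ^ ((s : ℤ) + 1) = β
  field_simp

/-- Iterated skew commutators: `v ↦ y v - c_p v y` applied for `p = 0, …, m - 1`. -/
def skewIter (c : ℕ → F) (y w : B) : ℕ → B
  | 0 => w
  | p + 1 => y * skewIter c y w p - c p • (skewIter c y w p * y)

theorem skewIter_eq_sum (c : ℕ → F) (t : ℕ → ℕ → F) (h00 : t 0 0 = 1)
    (h0 : ∀ m, t (m + 1) 0 = t m 0) (hl : ∀ m, t (m + 1) (m + 1) = -(c m * t m m))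
    (hs : ∀ m r, r < m → t (m + 1) (r + 1) = t m (r + 1) - c m * t m r) (y w : B) (m : ℕ) :
    skewIter c y w m = ∑ r ∈ Finset.range (m + 1), t m r • (y ^ (m - r) * w * y ^ r) := by
  induction m with
  | zero => simp [skewIter, h00]
  | succ m ih =>
    have e1 : y * skewIter c y w m = ∑ r ∈ Finset.range m,
        t m (r + 1) • (y ^ (m - r) * w * y ^ (r + 1)) + t m 0 • (y ^ (m + 1) * w) := by
      rw [ih, Finset.sum_range_succ', mul_add, Finset.mul_sum]
      congr 1
      · refine Finset.sum_congr rfl fun r hr => ?_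
        have : m - r = (m - (r + 1)) + 1 := by have := Finset.mem_range.1 hr; omega
        rw [mul_smul_comm, this, pow_succ' y (m - (r + 1))]
        simp only [mul_assoc]
      · simp [pow_succ', mul_assoc]
    have e2 : c m • (skewIter c y w m * y) = ∑ r ∈ Finset.range m,
        (c m * t m r) • (y ^ (m - r) * w * y ^ (r + 1)) + (c m * t m m) • (w * y ^ (m + 1)) := by
      rw [ih, Finset.sum_range_succ, add_mul, Finset.sum_mul, smul_add, Finset.smul_sum]
      congr 1
      · refine Finset.sum_congr rfl fun r _ => ?_
        rw [smul_mul_assoc, smul_smul, pow_succ]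
        simp only [mul_assoc]
      · simp [pow_succ, mul_assoc, smul_smul]
    have e3 : ∑ r ∈ Finset.range m, t (m + 1) (r + 1) • (y ^ (m - r) * w * y ^ (r + 1)) =
        ∑ r ∈ Finset.range m, t m (r + 1) • (y ^ (m - r) * w * y ^ (r + 1)) -
        ∑ r ∈ Finset.range m, (c m * t m r) • (y ^ (m - r) * w * y ^ (r + 1)) := by
      rw [← Finset.sum_sub_distrib]
      refine Finset.sum_congr rfl fun r hr => ?_
      rw [hs m r (Finset.mem_range.1 hr), sub_smul]
    rw [skewIter, e1, e2, Finset.sum_range_succ', Finset.sum_range_succ]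
    simp only [Nat.add_sub_add_right, e3, h0, hl, Nat.sub_self, Nat.sub_zero, pow_zero, one_mul,
      mul_one]
    module

/-- The quantum Serre expression in `y` and `w` of degree `m` in `y`. -/
def quantumSerre (Q : F) (m : ℕ) (y w : B) : B :=
  ∑ r ∈ Finset.range (m + 1), ((-1 : F) ^ r * gaussBinom Q m r) • (y ^ (m - r) * w * y ^ r)

theorem quantumSerre_inv (Q : F) (m : ℕ) (y w : B) :
    quantumSerre Q⁻¹ m y w = quantumSerre Q m y w := by
  simp only [quantumSerre, gaussBinom_inv]

theorem quantumSerre_add (Q : F) (m : ℕ) (y w w' : B) :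
    quantumSerre Q m y (w + w') = quantumSerre Q m y w + quantumSerre Q m y w' := by
  simp only [quantumSerre, mul_add, add_mul, smul_add, Finset.sum_add_distrib]

theorem quantumSerre_smul_smul (Q : F) (m : ℕ) (b b' : F) (y w : B) :
    quantumSerre Q m (b • y) (b' • w) = (b ^ m * b') • quantumSerre Q m y w := by
  simp only [quantumSerre, Finset.smul_sum]
  refine Finset.sum_congr rfl fun r hr => ?_
  have : b ^ m = b ^ (m - r) * b ^ r := by
    rw [← pow_add]; congr 1; have := Finset.mem_range.1 hr; omega
  simp only [smul_pow, smul_smul, smul_mul_assoc, mul_smul_comm, this]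
  congr 1
  ring

/-- The quantum Serre expression factors as a product of skew commutators. -/
theorem quantumSerre_eq_skewIter {Q : F} (hQ : Q ≠ 0) (h : ∀ m : ℕ, 0 < m → Q ^ m ≠ 1)
    (N : ℕ) (y w : B) :
    quantumSerre Q (N + 1) y w = skewIter (fun p => Q ^ (2 * (p : ℤ) - N)) y w (N + 1) := by
  rw [skewIter_eq_sum _ (fun m r => (-1) ^ r * Q ^ ((r : ℤ) * (m - 1 - N)) * gaussBinom Q m r)]
  · refine Finset.sum_congr rfl fun r _ => ?_
    simp
  · simp [gaussBinom, quantumFactorial]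
  · intro m
    simp [gaussBinom_zero_right hQ h]
  · intro m
    have : (((m + 1 : ℕ) : ℤ)) * (((m + 1 : ℕ) : ℤ) - 1 - N) =
        (2 * (m : ℤ) - N) + (m : ℤ) * (m - 1 - N) := by push_cast; ring
    simp only [gaussBinom_self hQ h, this, zpow_add₀ hQ (2 * (m : ℤ) - N)]
    ring
  · intro m r hr
    have e1 : ((r + 1 : ℕ) : ℤ) * (m - 1 - N) =
        ((r + 1 : ℕ) : ℤ) * ((m + 1 : ℕ) - 1 - N) + (-((r : ℤ) + 1)) := by push_cast; ring
    have e2 : (2 * (m : ℤ) - N) + (r : ℤ) * (m - 1 - N) =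
        ((r + 1 : ℕ) : ℤ) * ((m + 1 : ℕ) - 1 - N) + ((m : ℤ) - r) := by push_cast; ring
    have e3 : Q ^ (2 * (m : ℤ) - N) * ((-1) ^ r * Q ^ ((r : ℤ) * (m - 1 - N)) * gaussBinom Q m r) =
        (-1) ^ r * (Q ^ (2 * (m : ℤ) - N) * Q ^ ((r : ℤ) * (m - 1 - N))) * gaussBinom Q m r := by
      ring
    rw [e3, ← zpow_add₀ hQ, e2, e1, gaussBinom_succ_succ hQ h hr]
    simp only [zpow_add₀ hQ (((r + 1 : ℕ) : ℤ) * ((m + 1 : ℕ) - 1 - N))]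
    ring

theorem mul_skewIter_comm {Q : F} (hQ : Q ≠ 0) (c : ℕ → F) (a : ℤ) {k f f' : B}
    (hf : f * k = Q ^ (-2 : ℤ) • (k * f)) (hf' : f' * k = Q ^ a • (k * f')) (p : ℕ) :
    skewIter c f f' p * k = Q ^ (a - 2 * p) • (k * skewIter c f f' p) := by
  induction p with
  | zero => simpa [skewIter] using hf'
  | succ p ih =>
    have e : a - 2 * ((p + 1 : ℕ) : ℤ) = (a - 2 * p) + (-2) := by push_cast; ring
    rw [e, zpow_add₀ hQ]
    simp only [skewIter, sub_mul, mul_sub, smul_mul_assoc, mul_smul_comm, mul_assoc, hf, ih]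
    simp only [← mul_assoc, hf, ih]
    simp only [smul_mul_assoc, smul_sub, smul_smul, ← mul_assoc]
    match_scalars <;> ring

/-- Adding a skew-commuting summand `k` to `f` does not change the iterated skew commutator. -/
theorem skewIter_add_left {Q : F} (hQ : Q ≠ 0) (N : ℤ) {k f f' : B}
    (hf : f * k = Q ^ (-2 : ℤ) • (k * f)) (hf' : f' * k = Q ^ N • (k * f')) (p : ℕ) :
    skewIter (fun p => Q ^ (2 * (p : ℤ) - N)) (k + f) f' p =
      skewIter (fun p => Q ^ (2 * (p : ℤ) - N)) f f' p := by
  induction p with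
  | zero => rfl
  | succ p ih =>
    have e : Q ^ (2 * (p : ℤ) - N) * Q ^ (N - 2 * (p : ℤ)) = 1 := by
      rw [← zpow_add₀ hQ]; simp
    rw [skewIter, ih, skewIter, mul_add, mul_skewIter_comm hQ _ N hf hf', add_mul, smul_add,
      smul_smul, e, one_smul]
    abel

theorem pow_mul_skew_comm {Q : F} (hQ : Q ≠ 0) (N : ℤ) {k k' f : B}
    (hf : f * k = Q ^ (-2 : ℤ) • (k * f)) (hk' : f * k' = Q ^ N • (k' * f)) (p : ℕ) :
    f * (k ^ p * k') = Q ^ (N - 2 * p) • (k ^ p * k' * f) := by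
  induction p with
  | zero => simpa using hk'
  | succ p ih =>
    have e : N - 2 * ((p + 1 : ℕ) : ℤ) = (N - 2 * p) + (-2) := by push_cast; ring
    rw [e, zpow_add₀ hQ, pow_succ', mul_assoc, ← mul_assoc f, hf, smul_mul_assoc, mul_assoc, ih,
      mul_smul_comm, smul_smul, mul_comm]
    simp only [mul_assoc]

theorem skewIter_torus {Q : F} (hQ : Q ≠ 0) (N : ℤ) {k k' f : B}
    (hf : f * k = Q ^ (-2 : ℤ) • (k * f)) (hk' : f * k' = Q ^ N • (k' * f))
    (hkk : k' * k = k * k') (p : ℕ) :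
    skewIter (fun p => Q ^ (N - 2 * (p : ℤ))) (k + f) k' p =
      (∏ s ∈ Finset.range p, (1 - Q ^ (N - 2 * (s : ℤ)))) • (k ^ p * k') := by
  induction p with
  | zero => simp [skewIter]
  | succ p ih =>
    have hk : k ^ p * k' * k = k ^ (p + 1) * k' := by
      rw [mul_assoc, hkk, ← mul_assoc, pow_succ]
    have hk2 : k * (k ^ p * k') = k ^ (p + 1) * k' := by
      rw [← mul_assoc, pow_succ']
    rw [skewIter, ih, Finset.prod_range_succ, mul_smul_comm, smul_mul_assoc, add_mul, mul_add,
      pow_mul_skew_comm hQ N hf hk', hk, hk2]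
    module

/-- The quantum Serre expression of `k + f` and `k' + f'` in the presence of skew commutation. -/
theorem quantumSerre_add_add {Q : F} (hQ : Q ≠ 0) (h : ∀ m : ℕ, 0 < m → Q ^ m ≠ 1)
    (N : ℕ) {k k' f f' : B} (hf : f * k = Q ^ (-2 : ℤ) • (k * f))
    (hf' : f' * k = Q ^ (N : ℤ) • (k * f')) (hk' : f * k' = Q ^ (N : ℤ) • (k' * f))
    (hkk : k' * k = k * k') :
    quantumSerre Q (N + 1) (k + f) (k' + f') =
      (∏ s ∈ Finset.range (N + 1), (1 - Q ^ ((N : ℤ) - 2 * s))) • (k ^ (N + 1) * k') +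
        quantumSerre Q (N + 1) f f' := by
  have hinv : ∀ m : ℕ, 0 < m → Q⁻¹ ^ m ≠ 1 := fun m hm => by
    rw [inv_pow]; exact inv_ne_one.2 (h m hm)
  rw [quantumSerre_add, ← quantumSerre_inv Q _ _ k', quantumSerre_eq_skewIter (inv_ne_zero hQ) hinv,
    quantumSerre_eq_skewIter hQ h, quantumSerre_eq_skewIter hQ h, skewIter_add_left hQ N hf hf',
    ← skewIter_torus hQ N hf hk' hkk]
  simp only [inv_zpow', neg_sub]

theorem skewIter_twist {Q : F} (hQ : Q ≠ 0) (a : ℤ) (c : ℕ → F) {k k' e e' : B}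
    (he : e * k = Q ^ (-2 : ℤ) • (k * e)) (he' : e' * k = Q ^ a • (k * e'))
    (hk' : e * k' = Q ^ a • (k' * e)) (hkk : k' * k = k * k') (p : ℕ) :
    skewIter c (k * e) (k' * e') p =
      (∏ s ∈ Finset.range p, Q ^ (a - 2 * (s : ℤ))) • (k ^ p * k' * skewIter c e e' p) := by
  induction p with
  | zero => simp [skewIter]
  | succ p ih =>
    have hk : ∀ v, k ^ p * k' * (k * v) = k ^ (p + 1) * k' * v := fun v => by
      rw [← mul_assoc, mul_assoc _ k', hkk, ← mul_assoc, pow_succ]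
    have e1 : k * e * (k ^ p * k' * skewIter c e e' p) =
        Q ^ (a - 2 * (p : ℤ)) • (k ^ (p + 1) * k' * (e * skewIter c e e' p)) := by
      rw [mul_assoc, ← mul_assoc e, pow_mul_skew_comm hQ a he hk', smul_mul_assoc, mul_smul_comm,
        pow_succ']
      simp only [mul_assoc]
    have e2 : k ^ p * k' * skewIter c e e' p * (k * e) =
        Q ^ (a - 2 * (p : ℤ)) • (k ^ (p + 1) * k' * (skewIter c e e' p * e)) := by
      rw [mul_assoc, ← mul_assoc _ k, mul_skewIter_comm hQ c a he he', smul_mul_assoc,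
        mul_smul_comm, mul_assoc k, hk]
    rw [skewIter, ih, mul_smul_comm, smul_mul_assoc, e1, e2, Finset.prod_range_succ, skewIter,
      mul_sub, mul_smul_comm]
    module

theorem quantumSerre_twist_eq_zero_iff {Q : F} (hQ : Q ≠ 0) (h : ∀ m : ℕ, 0 < m → Q ^ m ≠ 1)
    (N : ℕ) (a : ℤ) {k k' e e' : B} (hk : IsUnit k) (hu' : IsUnit k')
    (he : e * k = Q ^ (-2 : ℤ) • (k * e)) (he' : e' * k = Q ^ a • (k * e'))
    (hk' : e * k' = Q ^ a • (k' * e)) (hkk : k' * k = k * k') :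
    quantumSerre Q (N + 1) (k * e) (k' * e') = 0 ↔ quantumSerre Q (N + 1) e e' = 0 := by
  rw [quantumSerre_eq_skewIter hQ h, quantumSerre_eq_skewIter hQ h,
    skewIter_twist hQ a _ he he' hk' hkk, smul_eq_zero_iff_right,
    ((hk.pow _).mul hu').mul_right_eq_zero]
  exact Finset.prod_ne_zero_iff.2 fun s _ => zpow_ne_zero _ hQ

end QuantumSerre

section Presentations

variable {ι F B : Type*} [Field F] [Ring B] [Algebra F B]

/-- The families `E, F, X, X'` in an algebra satisfy the Chevalley relations of `U_q(g)`. -/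
structure IsChevalley (Q : ι → F) (A : Matrix ι ι ℤ) (E Φ X X' : ι → B) : Prop where
  mul_inv (i : ι) : X i * X' i = 1
  inv_mul (i : ι) : X' i * X i = 1
  comm (i j : ι) : X i * X j = X j * X i
  conj_E (i j : ι) : X i * E j * X' i = Q i ^ A i j • E j
  conj_F (i j : ι) : X i * Φ j * X' i = Q i ^ (-A i j) • Φ j
  commutator_self (i : ι) : E i * Φ i - Φ i * E i = (Q i - (Q i)⁻¹)⁻¹ • (X i - X' i)
  commutator_ne (i j : ι) : i ≠ j → E i * Φ j - Φ j * E i = 0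
  serre_E (i j : ι) : i ≠ j → quantumSerre (Q i) (1 - A i j).toNat (E i) (E j) = 0
  serre_F (i j : ι) : i ≠ j → quantumSerre (Q i) (1 - A i j).toNat (Φ i) (Φ j) = 0

/-- The families `X, X', Y, Z` in an algebra satisfy the equitable relations of `U_q(g)`. -/
structure IsEquitable (Q : ι → F) (A : Matrix ι ι ℤ) (X X' Y Z : ι → B) : Prop where
  mul_inv (i : ι) : X i * X' i = 1
  inv_mul (i : ι) : X' i * X i = 1
  comm (i j : ι) : X i * X j = X j * X i
  Y_X (i j : ι) : Y i * X j - Q i ^ A i j • (X j * Y i) = (1 - Q i ^ A i j) • (X' i * X j)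
  X_Z (i j : ι) : X i * Z j - Q i ^ A i j • (Z j * X i) = (1 - Q i ^ A i j) • (X i * X' j)
  Z_Y_self (i : ι) : Z i * Y i - Q i ^ 2 • (Y i * Z i) = (1 - Q i ^ 2) • (1 : B)
  Z_Y_ne (i j : ι) : i ≠ j →
    Z i * Y j - Q i ^ A i j • (Y j * Z i) = (1 - Q i ^ A i j) • (X' i * X' j)
  serre_Y (i j : ι) : i ≠ j → quantumSerre (Q i) (1 - A i j).toNat (Y i) (Y j) =
    (∏ s ∈ Finset.range ((-A i j).toNat + 1), (1 - Q i ^ (A i j + 2 * (s : ℤ)))) •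
      (X' i ^ (1 - A i j).toNat * X' j)
  serre_Z (i j : ι) : i ≠ j → quantumSerre (Q i) (1 - A i j).toNat (Z i) (Z j) =
    (∏ s ∈ Finset.range ((-A i j).toNat + 1), (1 - Q i ^ (A i j + 2 * (s : ℤ)))) •
      (X' i ^ (1 - A i j).toNat * X' j)

theorem conj_eq_smul_iff {x x' g : B} (h : x * x' = 1) (h' : x' * x = 1) (c : F) :
    x * g * x' = c • g ↔ g * x' = c • (x' * g) := by
  constructor
  · intro H
    rw [← mul_smul_comm, ← H, mul_assoc x, ← mul_assoc x', h', one_mul]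
  · intro H
    rw [mul_assoc, H, mul_smul_comm, ← mul_assoc, h, one_mul]

theorem conj_eq_smul_iff_mul_eq {x x' g : B} (h : x * x' = 1) (h' : x' * x = 1) (c : F) :
    x * g * x' = c • g ↔ x * g = c • (g * x) := by
  constructor
  · intro H
    rw [← smul_mul_assoc, ← H, mul_assoc _ x', h', mul_one]
  · intro H
    rw [H, smul_mul_assoc, mul_assoc, h, mul_one]

theorem conj_eq_zpow_neg_smul_iff {x x' g : B} (h : x * x' = 1) (h' : x' * x = 1) {q : F}
    (hq : q ≠ 0) (a : ℤ) : x * g * x' = q ^ (-a) • g ↔ g * x = q ^ a • (x * g) := by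
  rw [conj_eq_smul_iff_mul_eq h h', zpow_neg, eq_inv_smul_iff₀ (zpow_ne_zero a hq), eq_comm]

theorem equitable_mul_sub_smul_mul {x' y' e f : B} {c b t s : F} (hts : t * s = 1)
    (hc : x' * y' = y' * x') (he : e * y' = t • (y' * e)) (hf : f * x' = s • (x' * f)) :
    (x' - c • (x' * e)) * (y' + b • f) - t • ((y' + b • f) * (x' - c • (x' * e))) =
      (1 - t) • (x' * y') - (c * b) • (x' * (e * f - f * e)) := by
  have h1 : x' * e * y' = t • (x' * y' * e) := by
    rw [mul_assoc, he, mul_smul_comm, mul_assoc]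
  have h2 : f * (x' * e) = s • (x' * (f * e)) := by
    rw [← mul_assoc, hf, smul_mul_assoc, mul_assoc]
  have h3 : y' * (x' * e) = x' * y' * e := by rw [← mul_assoc, hc]
  simp only [sub_mul, mul_sub, add_mul, mul_add, smul_mul_assoc, mul_smul_comm, h1, h2, h3, hf,
    smul_add, smul_sub, smul_smul, mul_assoc x' e f, ← hc]
  match_scalars <;>
    first | ring1 | linear_combination -b * hts | linear_combination (c * b) * hts

/-- The equitable relations are the Chevalley relations after the change of generators. -/
theorem isEquitable_iff_isChevalley {Q : ι → F} {A : Matrix ι ι ℤ} (hQ : ∀ i, Q i ≠ 0)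
    (hroot : ∀ i, ∀ m : ℕ, 0 < m → Q i ^ m ≠ 1) (hsymm : ∀ i j, Q i ^ A i j = Q j ^ A j i)
    (hdiag : ∀ i, A i i = 2) (hoff : ∀ i j, i ≠ j → A i j ≤ 0) (E Φ X X' : ι → B) :
    IsEquitable Q A X X' (fun i => X' i + (Q i - (Q i)⁻¹) • Φ i)
      (fun i => X' i - (Q i * (Q i - (Q i)⁻¹)) • (X' i * E i)) ↔ IsChevalley Q A E Φ X X' := by
  have hb : ∀ i, Q i - (Q i)⁻¹ ≠ 0 := fun i => sub_inv_ne_zero_of_pow_ne_one (hQ i) (hroot i)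
  have hroot' : ∀ i, ∀ m : ℕ, 0 < m → (Q i)⁻¹ ^ m ≠ 1 := fun i m hm => by
    rw [inv_pow]; exact inv_ne_one.2 (hroot i m hm)
  suffices key : ∀ (hm : ∀ i, X i * X' i = 1) (hm' : ∀ i, X' i * X i = 1)
      (hc : ∀ i j, X i * X j = X j * X i),
      IsEquitable Q A X X' (fun i => X' i + (Q i - (Q i)⁻¹) • Φ i)
        (fun i => X' i - (Q i * (Q i - (Q i)⁻¹)) • (X' i * E i)) ↔ IsChevalley Q A E Φ X X' from
    ⟨fun H => (key H.mul_inv H.inv_mul H.comm).1 H, fun H => (key H.mul_inv H.inv_mul H.comm).2 H⟩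
  intro hm hm' hc
  have hcomm' : ∀ i j, X i * X' j = X' j * X i := fun i j =>
    (Commute.units_inv_right (u := ⟨X j, X' j, hm j, hm' j⟩) (hc i j))
  have hcomm'' : ∀ i j, X' i * X' j = X' j * X' i := fun i j =>
    (Commute.units_inv_left (u := ⟨X i, X' i, hm i, hm' i⟩) (hcomm' i j))
  have hu : ∀ i, IsUnit (X i) := fun i => ⟨⟨X i, X' i, hm i, hm' i⟩, rfl⟩
  have hu' : ∀ i, IsUnit (X' i) := fun i => ⟨⟨X' i, X i, hm' i, hm i⟩, rfl⟩
  have hF : ∀ i j, ((X' i + (Q i - (Q i)⁻¹) • Φ i) * X j -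
      Q i ^ A i j • (X j * (X' i + (Q i - (Q i)⁻¹) • Φ i)) = (1 - Q i ^ A i j) • (X' i * X j)) ↔
      X j * Φ i * X' j = Q j ^ (-A j i) • Φ i := fun i j => by
    rw [conj_eq_zpow_neg_smul_iff (hm j) (hm' j) (hQ j), ← hsymm i j, ← sub_eq_zero,
      ← sub_eq_zero (b := Q i ^ A i j • (X j * Φ i))]
    refine Iff.trans (Eq.congr_left ?_) (smul_eq_zero_iff_right (hb i))
    simp only [add_mul, mul_add, smul_mul_assoc, mul_smul_comm, hcomm' j i]
    module
  have hE : ∀ i j, (X i * (X' j - (Q j * (Q j - (Q j)⁻¹)) • (X' j * E j)) -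
      Q i ^ A i j • ((X' j - (Q j * (Q j - (Q j)⁻¹)) • (X' j * E j)) * X i) =
        (1 - Q i ^ A i j) • (X i * X' j)) ↔
      X i * E j * X' i = Q i ^ A i j • E j := fun i j => by
    rw [conj_eq_smul_iff_mul_eq (hm i) (hm' i), ← sub_eq_zero,
      ← sub_eq_zero (b := Q i ^ A i j • (E j * X i))]
    refine Iff.trans (Eq.congr_left ?_) ((smul_eq_zero_iff_right
      (neg_ne_zero.2 (mul_ne_zero (hQ j) (hb j)))).trans (hu' j).mul_right_eq_zero)
    simp only [sub_mul, mul_sub, smul_mul_assoc, mul_smul_comm, ← mul_assoc, hcomm' i j]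
    module
  by_cases hEF : (∀ i j, X i * E j * X' i = Q i ^ A i j • E j) ∧
      ∀ i j, X i * Φ j * X' i = Q i ^ (-A i j) • Φ j
  swap
  · exact ⟨fun H => (hEF ⟨fun i j => (hE i j).1 (H.X_Z i j), fun i j => (hF j i).1 (H.Y_X j i)⟩).elim,
      fun H => (hEF ⟨H.conj_E, H.conj_F⟩).elim⟩
  obtain ⟨hE1, hF1⟩ := hEF
  have hEx : ∀ i j, E j * X' i = Q i ^ A i j • (X' i * E j) := fun i j =>
    (conj_eq_smul_iff (hm i) (hm' i) _).1 (hE1 i j)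
  have hFx : ∀ i j, Φ j * X' i = Q i ^ (-A i j) • (X' i * Φ j) := fun i j =>
    (conj_eq_smul_iff (hm i) (hm' i) _).1 (hF1 i j)
  have hZY : ∀ i j, (X' i - (Q i * (Q i - (Q i)⁻¹)) • (X' i * E i)) *
      (X' j + (Q j - (Q j)⁻¹) • Φ j) - Q i ^ A i j • ((X' j + (Q j - (Q j)⁻¹) • Φ j) *
        (X' i - (Q i * (Q i - (Q i)⁻¹)) • (X' i * E i))) = (1 - Q i ^ A i j) • (X' i * X' j) -
      (Q i * (Q i - (Q i)⁻¹) * (Q j - (Q j)⁻¹)) • (X' i * (E i * Φ j - Φ j * E i)) := fun i j => by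
    refine equitable_mul_sub_smul_mul (s := Q i ^ (-A i j)) ?_ (hcomm'' i j) ?_ (hFx i j)
    · rw [← zpow_add₀ (hQ i)]; simp
    · rw [hEx j i, hsymm]
  have hself : ∀ i, ((X' i - (Q i * (Q i - (Q i)⁻¹)) • (X' i * E i)) *
      (X' i + (Q i - (Q i)⁻¹) • Φ i) - Q i ^ 2 • ((X' i + (Q i - (Q i)⁻¹) • Φ i) *
        (X' i - (Q i * (Q i - (Q i)⁻¹)) • (X' i * E i))) = (1 - Q i ^ 2) • (1 : B)) ↔
      E i * Φ i - Φ i * E i = (Q i - (Q i)⁻¹)⁻¹ • (X i - X' i) := fun i => by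
    have h := hZY i i
    have h2 : Q i ^ A i i = Q i ^ 2 := by rw [hdiag]; norm_cast
    rw [h2] at h
    rw [h, ← sub_eq_zero, ← sub_eq_zero (a := E i * Φ i - Φ i * E i)]
    refine Iff.trans (Eq.congr_left ?_) ((smul_eq_zero_iff_right (neg_ne_zero.2
      (mul_ne_zero (mul_ne_zero (hQ i) (hb i)) (hb i)))).trans (hu' i).mul_right_eq_zero)
    have hq : Q i * (Q i - (Q i)⁻¹) * (Q i - (Q i)⁻¹) * (Q i - (Q i)⁻¹)⁻¹ = Q i ^ 2 - 1 := by
      rw [mul_inv_cancel_right₀ (hb i), mul_sub, mul_inv_cancel₀ (hQ i), sq]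
    rw [neg_smul]
    simp only [mul_sub (X' i), mul_smul_comm, hm', smul_sub, smul_smul, hq]
    module
  have hne : ∀ i j, ((X' i - (Q i * (Q i - (Q i)⁻¹)) • (X' i * E i)) *
      (X' j + (Q j - (Q j)⁻¹) • Φ j) - Q i ^ A i j • ((X' j + (Q j - (Q j)⁻¹) • Φ j) *
        (X' i - (Q i * (Q i - (Q i)⁻¹)) • (X' i * E i))) = (1 - Q i ^ A i j) • (X' i * X' j)) ↔
      E i * Φ j - Φ j * E i = 0 := fun i j => by
    rw [hZY, sub_eq_self, smul_eq_zero_iff_right (mul_ne_zero (mul_ne_zero (hQ i) (hb i)) (hb j)),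
      (hu' i).mul_right_eq_zero]
  have hserreF : ∀ i j, i ≠ j → ((quantumSerre (Q i) (1 - A i j).toNat
      (X' i + (Q i - (Q i)⁻¹) • Φ i) (X' j + (Q j - (Q j)⁻¹) • Φ j) =
    (∏ s ∈ Finset.range ((-A i j).toNat + 1), (1 - Q i ^ (A i j + 2 * (s : ℤ)))) •
      (X' i ^ (1 - A i j).toNat * X' j)) ↔
      quantumSerre (Q i) (1 - A i j).toNat (Φ i) (Φ j) = 0) := fun i j hij => by
    obtain ⟨N, hN⟩ := Int.eq_ofNat_of_zero_le (neg_nonneg.2 (hoff i j hij))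
    have hA : A i j = -(N : ℤ) := by omega
    have e1 : (1 - A i j).toNat = N + 1 := by omega
    have e2 : (-A i j).toNat = N := by omega
    have hprod : ∏ s ∈ Finset.range (N + 1), (1 - Q i ^ ((N : ℤ) - 2 * s)) =
        ∏ s ∈ Finset.range (N + 1), (1 - Q i ^ (A i j + 2 * (s : ℤ))) := by
      rw [← Finset.prod_range_reflect]
      refine Finset.prod_congr rfl fun s hs => ?_
      have : ((N + 1 - 1 - s : ℕ) : ℤ) = N - s := by have := Finset.mem_range.1 hs; omega
      rw [this, hA]
      congr 2
      ring
    have h1 : Φ i * X' i = Q i ^ (-2 : ℤ) • (X' i * Φ i) := by rw [hFx, hdiag]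
    have h2 : Φ j * X' i = Q i ^ (N : ℤ) • (X' i * Φ j) := by rw [hFx, hA, neg_neg]
    have h3 : Φ i * X' j = Q i ^ (N : ℤ) • (X' j * Φ i) := by
      rw [hFx, zpow_neg, ← hsymm i j, ← zpow_neg, hA, neg_neg]
    rw [e1, e2, quantumSerre_add_add (hQ i) (hroot i) N _ _ _ (hcomm'' j i), hprod, add_eq_left,
      quantumSerre_smul_smul, smul_eq_zero_iff_right (mul_ne_zero (pow_ne_zero _ (hb i)) (hb j))]
    · rw [smul_mul_assoc, h1, mul_smul_comm, smul_comm]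
    · rw [smul_mul_assoc, h2, mul_smul_comm, smul_comm]
    · rw [smul_mul_assoc, h3, mul_smul_comm, smul_comm]
  have hserreE : ∀ i j, i ≠ j → ((quantumSerre (Q i) (1 - A i j).toNat
      (X' i - (Q i * (Q i - (Q i)⁻¹)) • (X' i * E i))
      (X' j - (Q j * (Q j - (Q j)⁻¹)) • (X' j * E j)) =
    (∏ s ∈ Finset.range ((-A i j).toNat + 1), (1 - Q i ^ (A i j + 2 * (s : ℤ)))) •
      (X' i ^ (1 - A i j).toNat * X' j)) ↔
      quantumSerre (Q i) (1 - A i j).toNat (E i) (E j) = 0) := fun i j hij => by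
    obtain ⟨N, hN⟩ := Int.eq_ofNat_of_zero_le (neg_nonneg.2 (hoff i j hij))
    have hA : A i j = -(N : ℤ) := by omega
    have e1 : (1 - A i j).toNat = N + 1 := by omega
    have e2 : (-A i j).toNat = N := by omega
    have hprod : ∏ s ∈ Finset.range (N + 1), (1 - (Q i)⁻¹ ^ ((N : ℤ) - 2 * s)) =
        ∏ s ∈ Finset.range (N + 1), (1 - Q i ^ (A i j + 2 * (s : ℤ))) := by
      refine Finset.prod_congr rfl fun s _ => ?_
      rw [hA, inv_zpow']
      congr 2
      ring
    have h1 : E i * X' i = (Q i)⁻¹ ^ (-2 : ℤ) • (X' i * E i) := by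
      rw [hEx, hdiag, inv_zpow', neg_neg]
    have h2 : E j * X' i = (Q i)⁻¹ ^ (N : ℤ) • (X' i * E j) := by rw [hEx, hA, inv_zpow']
    have h3 : E i * X' j = (Q i)⁻¹ ^ (N : ℤ) • (X' j * E i) := by
      rw [hEx, ← hsymm i j, hA, inv_zpow']
    rw [e1, e2, ← quantumSerre_inv, sub_eq_add_neg (X' i), sub_eq_add_neg (X' j), ← neg_smul, ← neg_smul,
      quantumSerre_add_add (inv_ne_zero (hQ i)) (hroot' i) N _ _ _ (hcomm'' j i), hprod,
      add_eq_left, quantumSerre_smul_smul, smul_eq_zero_iff_right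
        (mul_ne_zero (pow_ne_zero _ (neg_ne_zero.2 (mul_ne_zero (hQ i) (hb i))))
          (neg_ne_zero.2 (mul_ne_zero (hQ j) (hb j)))),
      quantumSerre_twist_eq_zero_iff (inv_ne_zero (hQ i)) (hroot' i) N N (hu' i) (hu' j) h1 h2 h3
        (hcomm'' j i), quantumSerre_inv]
    · rw [smul_mul_assoc, mul_assoc, h1, mul_smul_comm, mul_smul_comm, smul_comm]
    · rw [smul_mul_assoc, mul_assoc, h2, mul_smul_comm, mul_smul_comm, smul_comm, ← mul_assoc,
        hcomm'' j i, mul_assoc]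
    · rw [smul_mul_assoc, mul_assoc, h3, mul_smul_comm, mul_smul_comm, smul_comm, ← mul_assoc,
        hcomm'' i j, mul_assoc]
  constructor
  · intro H
    exact ⟨hm, hm', hc, hE1, hF1, fun i => (hself i).1 (H.Z_Y_self i),
      fun i j hij => (hne i j).1 (H.Z_Y_ne i j hij),
      fun i j hij => (hserreE i j hij).1 (H.serre_Z i j hij),
      fun i j hij => (hserreF i j hij).1 (H.serre_Y i j hij)⟩
  · intro H
    exact ⟨hm, hm', hc, fun i j => (hF i j).2 (hF1 j i), fun i j => (hE i j).2 (hE1 i j),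
      fun i => (hself i).2 (H.commutator_self i),
      fun i j hij => (hne i j).2 (H.commutator_ne i j hij),
      fun i j hij => (hserreF i j hij).2 (H.serre_F i j hij),
      fun i j hij => (hserreE i j hij).2 (H.serre_E i j hij)⟩

end Presentations

section Presented

variable {K : Type} [Field K] {n : ℕ} {A : Matrix (Fin n) (Fin n) ℤ} {d : Fin n → ℕ}

theorem qi_ne_zero (K : Type) [Field K] (m : ℕ) : qi K m ≠ 0 :=
  pow_ne_zero _ RatFunc.X_ne_zero

theorem qi_pow_ne_one (K : Type) [Field K] {e : ℕ} (he : 0 < e) (m : ℕ) (hm : 0 < m) :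
    qi K e ^ m ≠ 1 := by
  intro h
  rw [qi, qv, ← pow_mul, ← RatFunc.algebraMap_X, ← map_pow, ← map_one (algebraMap (Polynomial K) (RatFunc K)),
    (RatFunc.algebraMap_injective K).eq_iff] at h
  have := congrArg Polynomial.natDegree h
  rw [Polynomial.natDegree_X_pow, Polynomial.natDegree_one] at this
  exact (Nat.mul_pos he hm).ne' this

theorem qi_zpow_eq_qi_zpow {e e' : ℕ} {a a' : ℤ} (h : (e : ℤ) * a = e' * a') :
    qi K e ^ a = qi K e' ^ a' := by
  simp only [qi, ← zpow_natCast, ← zpow_mul, h]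

theorem qfac_eq_quantumFactorial (e m : ℕ) : qfac K e m = quantumFactorial (qi K e) m := by
  induction m with
  | zero => rfl
  | succ m ih => simp only [qfac, quantumFactorial, ih]; rfl

theorem qbin_eq_gaussBinom (e m r : ℕ) : qbin K e m r = gaussBinom (qi K e) m r := by
  simp only [qbin, gaussBinom, qfac_eq_quantumFactorial]

theorem isChevalley_gen (K : Type) [Field K] {n : ℕ} (A : Matrix (Fin n) (Fin n) ℤ)
    (d : Fin n → ℕ) : IsChevalley (fun i => qi K (d i)) A (genE K A d) (genF K A d) (genK K A d)
      (genKinv K A d) where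
  mul_inv i := by
    simpa [genE, genF, genK, genKinv] using
      RingQuot.mkAlgHom_rel (Kq K) (CRel.R1a (K := K) (A := A) (d := d) i)
  inv_mul i := by
    simpa [genE, genF, genK, genKinv] using
      RingQuot.mkAlgHom_rel (Kq K) (CRel.R1b (K := K) (A := A) (d := d) i)
  comm i j := by
    simpa [genE, genF, genK, genKinv] using
      RingQuot.mkAlgHom_rel (Kq K) (CRel.R2 (K := K) (A := A) (d := d) i j)
  conj_E i j := by
    simpa [genE, genF, genK, genKinv] using
      RingQuot.mkAlgHom_rel (Kq K) (CRel.R3 (K := K) (A := A) (d := d) i j)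
  conj_F i j := by
    simpa only [genE, genF, genK, genKinv, map_mul, map_smul] using
      RingQuot.mkAlgHom_rel (Kq K) (CRel.R4 (K := K) (A := A) (d := d) i j)
  commutator_self i := by
    simpa [genE, genF, genK, genKinv] using
      RingQuot.mkAlgHom_rel (Kq K) (CRel.R5 (K := K) (A := A) (d := d) i i)
  commutator_ne i j hij := by
    simpa [hij, genE, genF, genK, genKinv] using
      RingQuot.mkAlgHom_rel (Kq K) (CRel.R5 (K := K) (A := A) (d := d) i j)
  serre_E i j hij := by
    simpa only [genE, genF, genK, genKinv, quantumSerre, map_sum, map_mul, map_pow, map_smul, map_zero, qbin_eq_gaussBinom] using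
      RingQuot.mkAlgHom_rel (Kq K) (CRel.R6 (K := K) (A := A) (d := d) i j hij)
  serre_F i j hij := by
    simpa only [genE, genF, genK, genKinv, quantumSerre, map_sum, map_mul, map_pow, map_smul, map_zero, qbin_eq_gaussBinom] using
      RingQuot.mkAlgHom_rel (Kq K) (CRel.R7 (K := K) (A := A) (d := d) i j hij)

theorem isEquitable_gen (K : Type) [Field K] {n : ℕ} (A : Matrix (Fin n) (Fin n) ℤ)
    (d : Fin n → ℕ) : IsEquitable (fun i => qi K (d i)) A (genX K A d) (genXinv K A d)
      (genY K A d) (genZ K A d) where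
  mul_inv i := by
    simpa [genX, genXinv, genY, genZ] using
      RingQuot.mkAlgHom_rel (Kq K) (ERel.E1a (K := K) (A := A) (d := d) i)
  inv_mul i := by
    simpa [genX, genXinv, genY, genZ] using
      RingQuot.mkAlgHom_rel (Kq K) (ERel.E1b (K := K) (A := A) (d := d) i)
  comm i j := by
    simpa [genX, genXinv, genY, genZ] using
      RingQuot.mkAlgHom_rel (Kq K) (ERel.E2 (K := K) (A := A) (d := d) i j)
  Y_X i j := by
    simpa only [genX, genXinv, genY, genZ, map_mul, map_smul, map_sub] using
      RingQuot.mkAlgHom_rel (Kq K) (ERel.E3 (K := K) (A := A) (d := d) i j)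
  X_Z i j := by
    simpa only [genX, genXinv, genY, genZ, map_mul, map_smul, map_sub] using
      RingQuot.mkAlgHom_rel (Kq K) (ERel.E4 (K := K) (A := A) (d := d) i j)
  Z_Y_self i := by
    simpa only [genX, genXinv, genY, genZ, map_mul, map_smul, map_sub, map_one] using
      RingQuot.mkAlgHom_rel (Kq K) (ERel.E5 (K := K) (A := A) (d := d) i)
  Z_Y_ne i j hij := by
    simpa only [genX, genXinv, genY, genZ, map_mul, map_smul, map_sub] using
      RingQuot.mkAlgHom_rel (Kq K) (ERel.E6 (K := K) (A := A) (d := d) i j hij)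
  serre_Y i j hij := by
    simpa only [genX, genXinv, genY, genZ, quantumSerre, map_sum, map_mul, map_pow, map_smul, qbin_eq_gaussBinom] using
      RingQuot.mkAlgHom_rel (Kq K) (ERel.E7 (K := K) (A := A) (d := d) i j hij)
  serre_Z i j hij := by
    simpa only [genX, genXinv, genY, genZ, quantumSerre, map_sum, map_mul, map_pow, map_smul, qbin_eq_gaussBinom] using
      RingQuot.mkAlgHom_rel (Kq K) (ERel.E8 (K := K) (A := A) (d := d) i j hij)

/-- The universal property of `U_q(g)`. -/
theorem IsChevalley.exists_algHom {B : Type*} [Ring B] [Algebra (Kq K) B]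
    {E Φ X X' : Fin n → B} (H : IsChevalley (fun i => qi K (d i)) A E Φ X X') :
    ∃ f : Uqg K A d →ₐ[Kq K] B, ∀ i, f (genE K A d i) = E i ∧ f (genF K A d i) = Φ i ∧
      f (genK K A d i) = X i ∧ f (genKinv K A d i) = X' i := by
  let g : CGen n → B := fun
    | .E i => E i
    | .F i => Φ i
    | .K i => X i
    | .Kinv i => X' i
  have hg : ∀ ⦃x y⦄, CRel K A d x y → FreeAlgebra.lift (Kq K) g x = FreeAlgebra.lift (Kq K) g y := by
    intro x y hxy
    induction hxy with
    | R1a i => simpa [g] using H.mul_inv i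
    | R1b i => simpa [g] using H.inv_mul i
    | R2 i j => simpa [g] using H.comm i j
    | R3 i j => simpa [g] using H.conj_E i j
    | R4 i j => simpa only [map_mul, map_smul, lift_ι_apply] using H.conj_F i j
    | R5 i j =>
      split_ifs with hij
      · subst hij
        simpa [g] using H.commutator_self i
      · simpa [g] using H.commutator_ne i j hij
    | R6 i j hij =>
      simpa only [quantumSerre, map_sum, map_mul, map_pow, map_smul, map_zero, qbin_eq_gaussBinom,
        lift_ι_apply] using H.serre_E i j hij
    | R7 i j hij =>
      simpa only [quantumSerre, map_sum, map_mul, map_pow, map_smul, map_zero, qbin_eq_gaussBinom,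
        lift_ι_apply] using H.serre_F i j hij
  refine ⟨RingQuot.liftAlgHom (Kq K) ⟨FreeAlgebra.lift (Kq K) g, hg⟩, fun i => ?_⟩
  simp [genE, genF, genK, genKinv, g]

/-- The universal property of the equitable algebra. -/
theorem IsEquitable.exists_algHom {B : Type*} [Ring B] [Algebra (Kq K) B]
    {X X' Y Z : Fin n → B} (H : IsEquitable (fun i => qi K (d i)) A X X' Y Z) :
    ∃ f : Ueqg K A d →ₐ[Kq K] B, ∀ i, f (genX K A d i) = X i ∧ f (genXinv K A d i) = X' i ∧
      f (genY K A d i) = Y i ∧ f (genZ K A d i) = Z i := by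
  let g : EGen n → B := fun
    | .X i => X i
    | .Xinv i => X' i
    | .Y i => Y i
    | .Z i => Z i
  have hg : ∀ ⦃x y⦄, ERel K A d x y → FreeAlgebra.lift (Kq K) g x = FreeAlgebra.lift (Kq K) g y := by
    intro x y hxy
    induction hxy with
    | E1a i => simpa [g] using H.mul_inv i
    | E1b i => simpa [g] using H.inv_mul i
    | E2 i j => simpa [g] using H.comm i j
    | E3 i j => simpa only [map_mul, map_smul, map_sub, lift_ι_apply] using H.Y_X i j
    | E4 i j => simpa only [map_mul, map_smul, map_sub, lift_ι_apply] using H.X_Z i j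
    | E5 i => simpa only [map_mul, map_smul, map_sub, map_one, lift_ι_apply] using H.Z_Y_self i
    | E6 i j hij => simpa only [map_mul, map_smul, map_sub, lift_ι_apply] using H.Z_Y_ne i j hij
    | E7 i j hij =>
      simpa only [quantumSerre, map_sum, map_mul, map_pow, map_smul, qbin_eq_gaussBinom,
        lift_ι_apply] using H.serre_Y i j hij
    | E8 i j hij =>
      simpa only [quantumSerre, map_sum, map_mul, map_pow, map_smul, qbin_eq_gaussBinom,
        lift_ι_apply] using H.serre_Z i j hij
  refine ⟨RingQuot.liftAlgHom (Kq K) ⟨FreeAlgebra.lift (Kq K) g, hg⟩, fun i => ?_⟩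
  simp [genX, genXinv, genY, genZ, g]

theorem Uqg.algHom_ext {B : Type*} [Ring B] [Algebra (Kq K) B] {f g : Uqg K A d →ₐ[Kq K] B}
    (hE : ∀ i, f (genE K A d i) = g (genE K A d i)) (hF : ∀ i, f (genF K A d i) = g (genF K A d i))
    (hK : ∀ i, f (genK K A d i) = g (genK K A d i))
    (hK' : ∀ i, f (genKinv K A d i) = g (genKinv K A d i)) : f = g := by
  refine RingQuot.ringQuot_ext' _ _ _ (FreeAlgebra.hom_ext (funext fun x => ?_))
  cases x with
  | E i => exact hE i
  | F i => exact hF i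
  | K i => exact hK i
  | Kinv i => exact hK' i

theorem Ueqg.algHom_ext {B : Type*} [Ring B] [Algebra (Kq K) B] {f g : Ueqg K A d →ₐ[Kq K] B}
    (hX : ∀ i, f (genX K A d i) = g (genX K A d i))
    (hX' : ∀ i, f (genXinv K A d i) = g (genXinv K A d i))
    (hY : ∀ i, f (genY K A d i) = g (genY K A d i))
    (hZ : ∀ i, f (genZ K A d i) = g (genZ K A d i)) : f = g := by
  refine RingQuot.ringQuot_ext' _ _ _ (FreeAlgebra.hom_ext (funext fun x => ?_))
  cases x with
  | X i => exact hX i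
  | Xinv i => exact hX' i
  | Y i => exact hY i
  | Z i => exact hZ i

end Presented

/-- For a symmetrizable generalized Cartan matrix, the equitable algebra
`U` is isomorphic to `U_q(g)` via an isomorphism `θ` with `θ(X_i^{±1}) = K_i^{±1}`,
`θ(Y_i) = K_i⁻¹ + F_i(q_i - q_i⁻¹)`, `θ(Z_i) = K_i⁻¹ - K_i⁻¹E_i q_i(q_i - q_i⁻¹)`, whose
inverse satisfies `θ⁻¹(E_i) = (1 - X_iZ_i)q_i⁻¹(q_i - q_i⁻¹)⁻¹`,
`θ⁻¹(F_i) = (Y_i - X_i⁻¹)(q_i - q_i⁻¹)⁻¹`, `θ⁻¹(K_i^{±1}) = X_i^{±1}`. -/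
theorem equitable_presentation_Uqg (K : Type) [Field K] {n : ℕ}
    (A : Matrix (Fin n) (Fin n) ℤ) (d : Fin n → ℕ) (hA : IsSymmetrizableGCM A d) :
    ∃ θ : Ueqg K A d ≃ₐ[Kq K] Uqg K A d, ∀ i : Fin n,
      θ (genX K A d i) = genK K A d i ∧
      θ (genXinv K A d i) = genKinv K A d i ∧
      θ (genY K A d i) = genKinv K A d i + (qi K (d i) - (qi K (d i))⁻¹) • genF K A d i ∧
      θ (genZ K A d i) = genKinv K A d i -
        (qi K (d i) * (qi K (d i) - (qi K (d i))⁻¹)) • (genKinv K A d i * genE K A d i) ∧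
      θ.symm (genE K A d i) = ((qi K (d i))⁻¹ * (qi K (d i) - (qi K (d i))⁻¹)⁻¹) •
        (1 - genX K A d i * genZ K A d i) ∧
      θ.symm (genF K A d i) = (qi K (d i) - (qi K (d i))⁻¹)⁻¹ •
        (genY K A d i - genXinv K A d i) ∧
      θ.symm (genK K A d i) = genX K A d i ∧
      θ.symm (genKinv K A d i) = genXinv K A d i := by
  obtain ⟨-, hdiag, hoff, hd, -, hsymm⟩ := hA
  have hQ : ∀ i, qi K (d i) ≠ 0 := fun i => qi_ne_zero K (d i)
  have hroot : ∀ i, ∀ m : ℕ, 0 < m → qi K (d i) ^ m ≠ 1 := fun i => qi_pow_ne_one K (hd i)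
  have hb : ∀ i, qi K (d i) - (qi K (d i))⁻¹ ≠ 0 := fun i =>
    sub_inv_ne_zero_of_pow_ne_one (hQ i) (hroot i)
  have hq : ∀ i j, qi K (d i) ^ A i j = qi K (d j) ^ A j i := fun i j =>
    qi_zpow_eq_qi_zpow (hsymm i j)
  obtain ⟨f, hf⟩ := ((isEquitable_iff_isChevalley (Q := fun i => qi K (d i)) hQ hroot hq hdiag
    hoff _ _ _ _).2 (isChevalley_gen K A d)).exists_algHom
  let E : Fin n → Ueqg K A d := fun i =>
    ((qi K (d i))⁻¹ * (qi K (d i) - (qi K (d i))⁻¹)⁻¹) • (1 - genX K A d i * genZ K A d i)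
  let Φ : Fin n → Ueqg K A d := fun i =>
    (qi K (d i) - (qi K (d i))⁻¹)⁻¹ • (genY K A d i - genXinv K A d i)
  have hY : ∀ i, genXinv K A d i + (qi K (d i) - (qi K (d i))⁻¹) • Φ i = genY K A d i := fun i => by
    simp only [Φ]
    rw [smul_inv_smul₀ (hb i), add_sub_cancel]
  have hZ : ∀ i, genXinv K A d i - (qi K (d i) * (qi K (d i) - (qi K (d i))⁻¹)) •
      (genXinv K A d i * E i) = genZ K A d i := fun i => by
    simp only [E]
    rw [mul_smul_comm, ← mul_inv, smul_inv_smul₀ (mul_ne_zero (hQ i) (hb i)), mul_sub, mul_one,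
      ← mul_assoc, (isEquitable_gen K A d).inv_mul, one_mul, sub_sub_cancel]
  have hU : IsChevalley (fun i => qi K (d i)) A E Φ (genX K A d) (genXinv K A d) := by
    refine (isEquitable_iff_isChevalley hQ hroot hq hdiag hoff _ _ _ _).1 ?_
    rw [funext hY, funext hZ]
    exact isEquitable_gen K A d
  obtain ⟨g, hg⟩ := hU.exists_algHom
  choose hfX hfX' hfY hfZ using hf
  choose hgE hgF hgK hgK' using hg
  have hfE : ∀ i, f (E i) = genE K A d i := fun i => by
    simp only [E, map_smul, map_sub, map_mul, map_one, hfX, hfZ]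
    rw [mul_sub, (isChevalley_gen K A d).mul_inv, sub_sub_cancel, mul_smul_comm, ← mul_assoc,
      (isChevalley_gen K A d).mul_inv, one_mul, ← mul_inv,
      inv_smul_smul₀ (mul_ne_zero (hQ i) (hb i))]
  have hfF : ∀ i, f (Φ i) = genF K A d i := fun i => by
    simp only [Φ, map_smul, map_sub, hfX', hfY]
    rw [add_sub_cancel_left, inv_smul_smul₀ (hb i)]
  have hgY : ∀ i, g (f (genY K A d i)) = genY K A d i := fun i => by
    rw [hfY, map_add, map_smul, hgK', hgF, hY]
  have hgZ : ∀ i, g (f (genZ K A d i)) = genZ K A d i := fun i => by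
    rw [hfZ, map_sub, map_smul, map_mul, hgK', hgE, hZ]
  let θ : Ueqg K A d ≃ₐ[Kq K] Uqg K A d := AlgEquiv.ofAlgHom f g
    (Uqg.algHom_ext (fun i => by simp [hgE, hfE]) (fun i => by simp [hgF, hfF])
      (fun i => by simp [hgK, hfX]) (fun i => by simp [hgK', hfX']))
    (Ueqg.algHom_ext (fun i => by simp [hgK, hfX]) (fun i => by simp [hgK', hfX'])
      (fun i => by simp [hgY]) (fun i => by simp [hgZ]))
  exact ⟨θ, fun i => ⟨hfX i, hfX' i, hfY i, hfZ i, hgE i, hgF i, hgK i, hgK' i⟩⟩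
end

section
/- In U_q(g), the elements X̂_i^{±1} = K_i^{±1}, Ŷ_i = K_i^{-1} + F_i(q_i - q_i^{-1}), Ẑ_i = K_i^{-1} - K_i^{-1}E_i q_i(q_i - q_i^{-1}) (1 ≤ i ≤ n) satisfy the equitable relations (E1)–(E8); consequently there exists a 𝕂(q)-algebra homomorphism from the equitable algebra U to U_q(g) sending X_i^{±1} ↦ X̂_i^{±1}, Y_i ↦ Ŷ_i, Z_i ↦ Ẑ_i. -/
open FreeAlgebra
open scoped TensorProduct

noncomputable section Statement4

variable (K : Type) [Field K] {n : ℕ} (A : Matrix (Fin n) (Fin n) ℤ) (d : Fin n → ℕ)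

/-- `X̂_i = K_i`. -/
def hatX (i : Fin n) : Uqg K A d := genK K A d i
/-- `X̂_i⁻¹ = K_i⁻¹`. -/
def hatXinv (i : Fin n) : Uqg K A d := genKinv K A d i
/-- `Ŷ_i = K_i⁻¹ + F_i(q_i - q_i⁻¹)`. -/
def hatY (i : Fin n) : Uqg K A d :=
  genKinv K A d i + (qi K (d i) - (qi K (d i))⁻¹) • genF K A d i
/-- `Ẑ_i = K_i⁻¹ - K_i⁻¹E_i q_i(q_i - q_i⁻¹)`. -/
def hatZ (i : Fin n) : Uqg K A d :=
  genKinv K A d i -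
    (qi K (d i) * (qi K (d i) - (qi K (d i))⁻¹)) • (genKinv K A d i * genE K A d i)

section QuantumBinomial

variable (K : Type) [Field K]

lemma qi_ne_zero_s4 (di : ℕ) : qi K di ≠ 0 :=
  pow_ne_zero _ RatFunc.X_ne_zero

lemma qv_pow_ne_one {m : ℕ} (hm : 0 < m) : qv K ^ m ≠ 1 := by
  intro h
  have h' : algebraMap (Polynomial K) (RatFunc K) (Polynomial.X ^ m) =
      algebraMap (Polynomial K) (RatFunc K) 1 := by
    rw [map_pow, map_one, RatFunc.algebraMap_X]
    exact h
  have h2 := congrArg Polynomial.natDegree (RatFunc.algebraMap_injective K h')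
  rw [Polynomial.natDegree_X_pow, Polynomial.natDegree_one] at h2
  omega

lemma qi_pow_ne_inv_pow {di m : ℕ} (hd : 0 < di) (hm : 0 < m) :
    qi K di ^ m ≠ (qi K di ^ m)⁻¹ := by
  intro h
  have h0 : qi K di ^ m ≠ 0 := pow_ne_zero _ (qi_ne_zero_s4 K di)
  have h1 : qi K di ^ m * qi K di ^ m = 1 := by
    nth_rewrite 2 [h]
    exact mul_inv_cancel₀ h0
  rw [qi, ← pow_mul, ← pow_add] at h1
  exact qv_pow_ne_one K (by positivity) h1

lemma qi_sub_inv_ne_zero {di : ℕ} (hd : 0 < di) : qi K di - (qi K di)⁻¹ ≠ 0 := by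
  simpa [sub_eq_zero] using qi_pow_ne_inv_pow K hd one_pos

lemma qnum_ne_zero {di : ℕ} (hd : 0 < di) (m : ℕ) : qnum K di (m + 1) ≠ 0 := by
  refine div_ne_zero (sub_ne_zero.mpr ?_) (qi_sub_inv_ne_zero K hd)
  rw [zpow_neg]
  exact_mod_cast qi_pow_ne_inv_pow K hd m.succ_pos

lemma qfac_ne_zero {di : ℕ} (hd : 0 < di) (m : ℕ) : qfac K di m ≠ 0 := by
  induction m with
  | zero => exact one_ne_zero
  | succ m ih => exact mul_ne_zero (qnum_ne_zero K hd m) ih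

lemma qbin_zero_right {di : ℕ} (hd : 0 < di) (m : ℕ) : qbin K di m 0 = 1 := by
  simp [qbin, qfac, qfac_ne_zero K hd m]

lemma qbin_self {di : ℕ} (hd : 0 < di) (m : ℕ) : qbin K di m m = 1 := by
  simp [qbin, qfac, qfac_ne_zero K hd m]

/-- Addition formula for quantum integers, in both of its `q ↔ q⁻¹` forms. -/
lemma qnum_add {di : ℕ} {p : Kq K} (hp : p = qi K di ∨ p = (qi K di)⁻¹) (m n : ℤ) :
    qnum K di (m + n) = p ^ (-n) * qnum K di m + p ^ m * qnum K di n := by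
  have h0 := qi_ne_zero_s4 K di
  rcases hp with rfl | rfl
  · simp only [qnum, neg_add, zpow_add₀ h0]
    ring
  · simp only [qnum, neg_add, zpow_add₀ h0, inv_zpow', neg_neg]
    ring

/-- Pascal's rule for Gaussian binomials, in both of its `q ↔ q⁻¹` forms. -/
lemma qbin_succ_succ {di : ℕ} (hd : 0 < di) {p : Kq K}
    (hp : p = qi K di ∨ p = (qi K di)⁻¹) (r s : ℕ) :
    qbin K di (r + 1 + s + 1) (r + 1) =
      p⁻¹ ^ (r + 1) * qbin K di (r + 1 + s) (r + 1) + p ^ (s + 1) * qbin K di (r + 1 + s) r := by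
  have hadd := qnum_add K hp (s + 1) (r + 1)
  have e1 : r + 1 + s + 1 - (r + 1) = s + 1 := by omega
  have e2 : r + 1 + s - (r + 1) = s := by omega
  have e3 : r + 1 + s - r = s + 1 := by omega
  have e4 : (((r + 1 + s : ℕ) : ℤ) + 1) = (s + 1) + (r + 1) := by push_cast; ring
  have hz : p ^ (-((r : ℤ) + 1)) = p⁻¹ ^ (r + 1) := by
    rw [zpow_neg, inv_pow]; norm_cast
  have hz' : p ^ ((s : ℤ) + 1) = p ^ (s + 1) := by norm_cast
  rw [hz, hz'] at hadd
  simp only [qbin, e1, e2, e3]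
  rw [qfac, e4, hadd, qfac.eq_2 K di r, qfac.eq_2 K di s]
  have h1 := qfac_ne_zero K hd r
  have h2 := qfac_ne_zero K hd s
  have h3 := qnum_ne_zero K hd r
  have h4 := qnum_ne_zero K hd s
  field_simp

end QuantumBinomial

section IteratedCommutator

variable {k R : Type*} [Field k] [Ring R] [Algebra k R]

/-- The iterated twisted commutator of `y` with `x`, with twist `c m` at the `m`-th step. -/
def qad (y : R) (c : ℕ → k) (x : R) : ℕ → R
  | 0 => x
  | m + 1 => y * qad y c x m - c m • (qad y c x m * y)

lemma qad_add (y : R) (c : ℕ → k) (x x' : R) (m : ℕ) :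
    qad y c (x + x') m = qad y c x m + qad y c x' m := by
  induction m with
  | zero => rfl
  | succ m ih =>
    simp only [qad, ih, mul_add, add_mul, smul_add]
    abel

lemma pow_mul_eq_smul {α : k} {a b : R} (h : a * b = α • (b * a)) (m : ℕ) :
    a ^ m * b = α ^ m • (b * a ^ m) := by
  induction m with
  | zero => simp
  | succ m ih =>
    rw [pow_succ, mul_assoc, h, mul_smul_comm, ← mul_assoc, ih, smul_mul_assoc, smul_smul,
      mul_assoc, pow_succ, mul_comm]

lemma mul_pow_eq_smul {α : k} {a b : R} (h : a * b = α • (b * a)) (m : ℕ) :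
    a * b ^ m = α ^ m • (b ^ m * a) := by
  induction m with
  | zero => simp
  | succ m ih =>
    rw [pow_succ, ← mul_assoc, ih, smul_mul_assoc, mul_assoc, h, mul_smul_comm, smul_smul,
      mul_assoc, pow_succ]

lemma qad_mul_comm {α β : k} {κ f x : R} (hf : κ * f = α • (f * κ)) (hx : κ * x = β • (x * κ))
    (c : ℕ → k) (m : ℕ) : κ * qad f c x m = (β * α ^ m) • (qad f c x m * κ) := by
  induction m with
  | zero => simpa [qad] using hx
  | succ m ih =>
    have h1 : κ * (f * qad f c x m) = (β * α ^ (m + 1)) • (f * qad f c x m * κ) := by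
      rw [← mul_assoc, hf, smul_mul_assoc, mul_assoc, ih, mul_smul_comm, smul_smul, mul_assoc]
      ring_nf
    have h2 : κ * (qad f c x m * f) = (β * α ^ (m + 1)) • (qad f c x m * f * κ) := by
      rw [← mul_assoc, ih, smul_mul_assoc, mul_assoc, hf, mul_smul_comm, smul_smul, ← mul_assoc]
      ring_nf
    rw [qad, mul_sub, mul_smul_comm, h1, h2, sub_mul, smul_mul_assoc, smul_sub,
      smul_comm (c m)]

lemma qad_add_of_comm {α β : k} {κ f x : R} (hf : κ * f = α • (f * κ))
    (hx : κ * x = β • (x * κ)) (m : ℕ) :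
    qad (κ + f) (fun m => β * α ^ m) x m = qad f (fun m => β * α ^ m) x m := by
  induction m with
  | zero => rfl
  | succ m ih =>
    simp only [qad, ih, add_mul, mul_add, qad_mul_comm hf hx, smul_add]
    abel

lemma qad_add_torus {α β : k} (hα : α ≠ 0) (hβ : β ≠ 0) {κ κ' f : R}
    (hf : κ * f = α • (f * κ)) (hf' : κ' * f = β • (f * κ')) (hκ : κ' * κ = κ * κ') (m : ℕ) :
    qad (κ + f) (fun m => (β * α ^ m)⁻¹) κ' m =
      (∏ s ∈ Finset.range m, (1 - (β * α ^ s)⁻¹)) • (κ ^ m * κ') := by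
  induction m with
  | zero => simp [qad]
  | succ m ih =>
    have h1 : κ ^ m * κ' * f = (β * α ^ m) • (f * (κ ^ m * κ')) := by
      rw [mul_assoc, hf', mul_smul_comm, ← mul_assoc, pow_mul_eq_smul hf, smul_mul_assoc,
        smul_smul, mul_assoc]
    have h2 : κ ^ m * κ' * κ = κ ^ (m + 1) * κ' := by
      rw [mul_assoc, hκ, ← mul_assoc, ← pow_succ]
    have h3 : κ * (κ ^ m * κ') = κ ^ (m + 1) * κ' := by
      rw [← mul_assoc, ← pow_succ']
    have h4 : β * α ^ m ≠ 0 := mul_ne_zero hβ (pow_ne_zero _ hα)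
    rw [qad, ih, Finset.prod_range_succ]
    simp only [mul_smul_comm, smul_mul_assoc, mul_add, add_mul, h1, h2, h3]
    match_scalars <;> field_simp
    ring

lemma exists_qad_smul_torus_mul {α β : k} {κ κ' e x : R} (he : e * κ = α • (κ * e))
    (he' : e * κ' = β • (κ' * e)) (hx : x * κ = β • (κ * x)) (hκ : κ' * κ = κ * κ')
    (l l' : k) (c : ℕ → k) (m : ℕ) :
    ∃ s : k, qad (l • (κ * e)) c (l' • (κ' * x)) m = s • (κ ^ m * κ' * qad e c x m) := by
  have hw (m : ℕ) : qad e c x m * κ = (β * α ^ m) • (κ * qad e c x m) := by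
    induction m with
    | zero => simpa [qad] using hx
    | succ m ih =>
      have h1 : e * qad e c x m * κ = (β * α ^ (m + 1)) • (κ * (e * qad e c x m)) := by
        rw [mul_assoc, ih, mul_smul_comm, ← mul_assoc, he, smul_mul_assoc, smul_smul, mul_assoc,
          mul_assoc, pow_succ]
      have h2 : qad e c x m * e * κ = (β * α ^ (m + 1)) • (κ * (qad e c x m * e)) := by
        rw [mul_assoc, he, mul_smul_comm, ← mul_assoc, ih, smul_mul_assoc, smul_smul, mul_assoc]
        ring_nf
      rw [qad, sub_mul, smul_mul_assoc, h1, h2, mul_sub, mul_smul_comm, smul_sub,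
        smul_comm (c m)]
  induction m with
  | zero => exact ⟨l', by simp [qad]⟩
  | succ m ih =>
    obtain ⟨s, hs⟩ := ih
    refine ⟨l * s * (β * α ^ m), ?_⟩
    have h1 : κ * e * (κ ^ m * κ' * qad e c x m) =
        (β * α ^ m) • (κ ^ (m + 1) * κ' * (e * qad e c x m)) := by
      calc κ * e * (κ ^ m * κ' * qad e c x m)
          = κ * (e * κ ^ m) * (κ' * qad e c x m) := by noncomm_ring
        _ = α ^ m • (κ * κ ^ m * (e * κ') * qad e c x m) := by
          rw [mul_pow_eq_smul he]
          simp only [mul_smul_comm, smul_mul_assoc, mul_assoc]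
        _ = _ := by
          rw [he', pow_succ']
          simp only [mul_smul_comm, smul_mul_assoc, mul_assoc, smul_smul, mul_comm]
    have h2 : κ ^ m * κ' * qad e c x m * (κ * e) =
        (β * α ^ m) • (κ ^ (m + 1) * κ' * (qad e c x m * e)) := by
      calc κ ^ m * κ' * qad e c x m * (κ * e)
          = κ ^ m * κ' * (qad e c x m * κ) * e := by noncomm_ring
        _ = (β * α ^ m) • (κ ^ m * (κ' * κ) * (qad e c x m * e)) := by
          rw [hw]
          simp only [mul_smul_comm, smul_mul_assoc, mul_assoc]
        _ = _ := by
          rw [hκ, pow_succ]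
          simp only [mul_assoc]
    rw [qad, hs, qad]
    simp only [smul_mul_assoc, mul_smul_comm, h1, h2, mul_sub]
    module

end IteratedCommutator

section QuantumSerre

variable (K : Type) [Field K] {R : Type*} [Ring R] [Algebra (Kq K) R]

/-- The left-hand side of the quantum Serre relation of degree `N`. -/
def serreSum (di N : ℕ) (y x : R) : R :=
  ∑ r ∈ Finset.range (N + 1), ((-1 : Kq K) ^ r * qbin K di N r) • (y ^ (N - r) * x * y ^ r)

/-- The `q`-binomial theorem for the commuting operators of left and right multiplication. -/
lemma qad_eq_sum {di : ℕ} (hd : 0 < di) {p : Kq K} (hp : p = qi K di ∨ p = (qi K di)⁻¹)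
    (z : Kq K) (y x : R) (M : ℕ) :
    qad y (fun m => z * (p ^ 2) ^ m) x M = ∑ r ∈ Finset.range (M + 1),
      ((-1 : Kq K) ^ r * (z * p ^ M * p⁻¹) ^ r * qbin K di M r) • (y ^ (M - r) * x * y ^ r) := by
  have hp0 : p ≠ 0 := by
    rcases hp with rfl | rfl
    · exact qi_ne_zero_s4 K di
    · exact inv_ne_zero (qi_ne_zero_s4 K di)
  induction M with
  | zero => simp [qad, qbin_self K hd]
  | succ M ih =>
    rw [qad, ih, Finset.mul_sum, Finset.sum_mul, Finset.smul_sum, Finset.sum_range_succ',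
      Finset.sum_range_succ _ M, Finset.sum_range_succ' _ (M + 1), Finset.sum_range_succ _ M,
      add_sub_add_comm, ← Finset.sum_sub_distrib, add_assoc, add_comm (_ • _) (_ • _)]
    have hlast : (z * (p ^ 2) ^ M) • (((-1 : Kq K) ^ M * (z * p ^ M * p⁻¹) ^ M * qbin K di M M) •
        (y ^ (M - M) * x * y ^ M) * y) =
        -(((-1 : Kq K) ^ (M + 1) * (z * p ^ (M + 1) * p⁻¹) ^ (M + 1) *
          qbin K di (M + 1) (M + 1)) • (y ^ (M + 1 - (M + 1)) * x * y ^ (M + 1))) := by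
      simp only [qbin_self K hd, Nat.sub_self, pow_zero, one_mul, smul_mul_assoc, smul_smul,
        mul_assoc x, ← pow_succ, ← neg_smul, mul_one]
      congr 1
      simp only [mul_pow, inv_pow, pow_succ]
      field_simp
      ring
    have hfirst : y * ((-1 : Kq K) ^ 0 * (z * p ^ M * p⁻¹) ^ 0 * qbin K di M 0) •
        (y ^ (M - 0) * x * y ^ 0) =
        ((-1 : Kq K) ^ 0 * (z * p ^ (M + 1) * p⁻¹) ^ 0 * qbin K di (M + 1) 0) •
        (y ^ (M + 1 - 0) * x * y ^ 0) := by
      simp [qbin_zero_right K hd, pow_succ', mul_assoc]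
    rw [hlast, hfirst, sub_neg_eq_add]
    congr 1
    refine Finset.sum_congr rfl fun r hr => ?_
    obtain ⟨s, rfl⟩ : ∃ s, M = r + 1 + s :=
      ⟨M - (r + 1), by have := Finset.mem_range.mp hr; omega⟩
    have e1 : r + 1 + s + 1 - (r + 1) = s + 1 := by omega
    have e2 : r + 1 + s - (r + 1) = s := by omega
    have e3 : r + 1 + s - r = s + 1 := by omega
    have h1 : y * (y ^ s * x * y ^ (r + 1)) = y ^ (s + 1) * x * y ^ (r + 1) := by
      rw [pow_succ' y s]
      simp only [mul_assoc]
    have h2 : y ^ (s + 1) * x * y ^ r * y = y ^ (s + 1) * x * y ^ (r + 1) := by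
      rw [pow_succ y r]
      simp only [mul_assoc]
    rw [e1, e2, e3, qbin_succ_succ K hd hp]
    simp only [mul_smul_comm, smul_mul_assoc, h1, h2, smul_smul, ← sub_smul]
    congr 1
    simp only [mul_pow, inv_pow, pow_succ, pow_add]
    field_simp
    ring

lemma serreSum_eq_qad {di : ℕ} (hd : 0 < di) {p : Kq K}
    (hp : p = qi K di ∨ p = (qi K di)⁻¹) {N : ℕ} {z : Kq K} (hz : z * p ^ N * p⁻¹ = 1)
    (y x : R) : serreSum K di N y x = qad y (fun m => z * (p ^ 2) ^ m) x N := by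
  simp [qad_eq_sum K hd hp, hz, serreSum]

/-- The equitable Serre relation follows from the Serre relation for the nilpotent parts. -/
lemma serreSum_add {di : ℕ} (hd : 0 < di) {p : Kq K} (hp : p = qi K di ∨ p = (qi K di)⁻¹)
    {N : ℕ} {β : Kq K} (hβ : β * p ^ N * p⁻¹ = 1) {κ κ' f f' : R}
    (hf : κ * f = p ^ 2 • (f * κ)) (hf' : κ' * f = β • (f * κ'))
    (hx : κ * f' = β • (f' * κ)) (hκ : κ' * κ = κ * κ') (hS : serreSum K di N f f' = 0) :
    serreSum K di N (κ + f) (κ' + f') =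
      (∏ s ∈ Finset.range N, (1 - (β * (p ^ 2) ^ s)⁻¹)) • (κ ^ N * κ') := by
  have hβ0 : β ≠ 0 := by rintro rfl; simp at hβ
  have hp0 : p ≠ 0 := by rintro rfl; simp at hβ
  have hp' : p⁻¹ = qi K di ∨ p⁻¹ = (qi K di)⁻¹ := by
    rcases hp with rfl | rfl
    · exact Or.inr rfl
    · exact Or.inl (inv_inv _)
  have hβ' : β⁻¹ * p⁻¹ ^ N * p⁻¹⁻¹ = 1 := by
    rw [inv_pow, ← mul_inv, ← mul_inv, hβ, inv_one]
  have hc : (fun m => β⁻¹ * (p⁻¹ ^ 2) ^ m) = fun m => (β * (p ^ 2) ^ m)⁻¹ := by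
    funext m
    simp [mul_comm]
  have h1 : serreSum K di N (κ + f) κ' = _ :=
    (serreSum_eq_qad K hd hp' hβ' _ _).trans
      (hc ▸ qad_add_torus (pow_ne_zero 2 hp0) hβ0 hf hf' hκ N)
  have h2 : serreSum K di N (κ + f) f' = 0 := by
    rw [serreSum_eq_qad K hd hp hβ, qad_add_of_comm hf hx, ← serreSum_eq_qad K hd hp hβ, hS]
  rw [← h1, ← add_zero (serreSum K di N (κ + f) κ'), ← h2]
  simp [serreSum, mul_add, add_mul, Finset.sum_add_distrib]

lemma serreSum_smul_torus_mul {di : ℕ} (hd : 0 < di) {N : ℕ} {α β : Kq K} {κ κ' e x : R}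
    (he : e * κ = α • (κ * e)) (he' : e * κ' = β • (κ' * e)) (hx : x * κ = β • (κ * x))
    (hκ : κ' * κ = κ * κ') (l l' : Kq K) (hS : serreSum K di N e x = 0) :
    serreSum K di N (l • (κ * e)) (l' • (κ' * x)) = 0 := by
  have hq := qi_ne_zero_s4 K di
  have hz : (qi K di * (qi K di ^ N)⁻¹) * qi K di ^ N * (qi K di)⁻¹ = 1 := by
    field_simp
  rw [serreSum_eq_qad K hd (Or.inl rfl) hz] at hS ⊢
  obtain ⟨s, hs⟩ := exists_qad_smul_torus_mul he he' hx hκ l l'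
    (fun m => (qi K di * (qi K di ^ N)⁻¹) * (qi K di ^ 2) ^ m) N
  rw [hs, hS, mul_zero, smul_zero]

end QuantumSerre

section EquitableIdentities

variable {k R : Type*} [Field k] [Ring R] [Algebra k R]

lemma sub_smul_eq_add_neg_smul (c : k) (x y : R) : x - c • y = x + (-c) • y := by
  rw [neg_smul, sub_eq_add_neg]

lemma add_smul_twisted_comm {a : k} {κ x f : R} (hf : f * x = a • (x * f)) (hκ : κ * x = x * κ)
    (c : k) : (κ + c • f) * x - a • (x * (κ + c • f)) = (1 - a) • (κ * x) := by
  simp only [add_mul, mul_add, smul_mul_assoc, mul_smul_comm, hf, hκ]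
  module

lemma sub_smul_twisted_comm {a : k} {κ x g : R} (hg : x * g = a • (g * x)) (hκ : κ * x = x * κ)
    (c : k) : x * (κ - c • g) - a • ((κ - c • g) * x) = (1 - a) • (x * κ) := by
  simp only [sub_mul, mul_sub, smul_mul_assoc, mul_smul_comm, hg, hκ]
  module

lemma twisted_comm_of_comm {a : k} {κ κ' e f : R} (hf : κ * f = a • (f * κ))
    (he : e * κ' = a • (κ' * e)) (hef : e * f = f * e) (hκ : κ' * κ = κ * κ') (c c' : k) :
    (κ - c • (κ * e)) * (κ' + c' • f) - a • ((κ' + c' • f) * (κ - c • (κ * e))) =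
      (1 - a) • (κ * κ') := by
  have h1 : κ * e * κ' = a • (κ * κ' * e) := by rw [mul_assoc, he, mul_smul_comm, mul_assoc]
  have h2 : κ * e * f = a • (f * κ * e) := by
    rw [mul_assoc, hef, ← mul_assoc, hf, smul_mul_assoc]
  simp only [add_mul, mul_add, sub_mul, mul_sub, smul_mul_assoc, mul_smul_comm, h1, h2, hf,
    ← mul_assoc, hκ]
  module

lemma twisted_comm_self {q : k} (hq : q ≠ 0) (hc : q - q⁻¹ ≠ 0) {x κ e f : R}
    (hκx : κ * x = 1) (hf : κ * f = q ^ 2 • (f * κ)) (he : e * κ = q ^ 2 • (κ * e))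
    (hef : e * f = f * e + (q - q⁻¹)⁻¹ • (x - κ)) :
    (κ - (q * (q - q⁻¹)) • (κ * e)) * (κ + (q - q⁻¹) • f) -
        q ^ 2 • ((κ + (q - q⁻¹) • f) * (κ - (q * (q - q⁻¹)) • (κ * e))) =
      (1 - q ^ 2) • (1 : R) := by
  have h1 : κ * e * κ = q ^ 2 • (κ * κ * e) := by rw [mul_assoc, he, mul_smul_comm, mul_assoc]
  have h2 : κ * e * f = q ^ 2 • (f * κ * e) + (q - q⁻¹)⁻¹ • (1 - κ * κ) := by
    rw [mul_assoc, hef, mul_add, ← mul_assoc, hf, smul_mul_assoc, mul_smul_comm, mul_sub, hκx]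
  simp only [add_mul, mul_add, sub_mul, mul_sub, smul_mul_assoc, mul_smul_comm, h1, h2, hf,
    ← mul_assoc]
  have h3 : q - q⁻¹ = (q ^ 2 - 1) / q := by field_simp
  have h4 : q ^ 2 - 1 ≠ 0 := fun h => hc (by rw [h3, h, zero_div])
  rw [h3]
  match_scalars <;> field_simp <;> ring

end EquitableIdentities

section ChevalleyRelations

variable (K : Type) [Field K] {n : ℕ} (A : Matrix (Fin n) (Fin n) ℤ) (d : Fin n → ℕ)

lemma genK_mul_genKinv (i : Fin n) : genK K A d i * genKinv K A d i = 1 := by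
  simpa [genK, genKinv] using RingQuot.mkAlgHom_rel (Kq K) (CRel.R1a (K := K) (A := A) (d := d) i)

lemma genKinv_mul_genK (i : Fin n) : genKinv K A d i * genK K A d i = 1 := by
  simpa [genK, genKinv] using RingQuot.mkAlgHom_rel (Kq K) (CRel.R1b (K := K) (A := A) (d := d) i)

lemma genK_comm (i j : Fin n) : genK K A d i * genK K A d j = genK K A d j * genK K A d i := by
  simpa [genK] using RingQuot.mkAlgHom_rel (Kq K) (CRel.R2 (K := K) (A := A) (d := d) i j)

lemma genKinv_genK_comm (i j : Fin n) :
    genKinv K A d i * genK K A d j = genK K A d j * genKinv K A d i := by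
  calc genKinv K A d i * genK K A d j
      = genKinv K A d i * (genK K A d j * genK K A d i) * genKinv K A d i := by
        simp only [mul_assoc, genK_mul_genKinv, mul_one]
    _ = (genKinv K A d i * genK K A d i) * genK K A d j * genKinv K A d i := by
        rw [genK_comm K A d j i]
        simp only [mul_assoc]
    _ = _ := by rw [genKinv_mul_genK, one_mul]

lemma genKinv_comm (i j : Fin n) :
    genKinv K A d i * genKinv K A d j = genKinv K A d j * genKinv K A d i := by
  calc genKinv K A d i * genKinv K A d j
      = genKinv K A d j * (genK K A d j * genKinv K A d i) * genKinv K A d j := by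
        rw [← mul_assoc, genKinv_mul_genK, one_mul]
    _ = genKinv K A d j * genKinv K A d i * (genK K A d j * genKinv K A d j) := by
        rw [← genKinv_genK_comm]
        simp only [mul_assoc]
    _ = _ := by rw [genK_mul_genKinv, mul_one]

lemma genK_mul_genE (i j : Fin n) :
    genK K A d i * genE K A d j = qi K (d i) ^ A i j • (genE K A d j * genK K A d i) := by
  have h : genK K A d i * genE K A d j * genKinv K A d i = qi K (d i) ^ A i j • genE K A d j := by
    simpa [genK, genE, genKinv] using
      RingQuot.mkAlgHom_rel (Kq K) (CRel.R3 (K := K) (A := A) (d := d) i j)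
  rw [← smul_mul_assoc, ← h, mul_assoc, genKinv_mul_genK, mul_one]

lemma genE_mul_genKinv (i j : Fin n) :
    genE K A d j * genKinv K A d i = qi K (d i) ^ A i j • (genKinv K A d i * genE K A d j) := by
  have h := congrArg (genKinv K A d i * · * genKinv K A d i) (genK_mul_genE K A d i j)
  simpa only [mul_smul_comm, smul_mul_assoc, ← mul_assoc, genKinv_mul_genK, one_mul,
    mul_assoc _ (genK K A d i), genK_mul_genKinv, mul_one] using h

lemma genF_mul_genK (i j : Fin n) :
    genF K A d j * genK K A d i = qi K (d i) ^ A i j • (genK K A d i * genF K A d j) := by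
  have h : genK K A d i * genF K A d j * genKinv K A d i =
      qi K (d i) ^ (-A i j) • genF K A d j := by
    simpa [genK, genF, genKinv] using
      RingQuot.mkAlgHom_rel (Kq K) (CRel.R4 (K := K) (A := A) (d := d) i j)
  have h' : genK K A d i * genF K A d j =
      qi K (d i) ^ (-A i j) • (genF K A d j * genK K A d i) := by
    rw [← smul_mul_assoc, ← h, mul_assoc, genKinv_mul_genK, mul_one]
  rw [h', smul_smul, ← zpow_add₀ (qi_ne_zero_s4 K _), add_neg_cancel, zpow_zero, one_smul]

lemma genKinv_mul_genF (i j : Fin n) :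
    genKinv K A d i * genF K A d j = qi K (d i) ^ A i j • (genF K A d j * genKinv K A d i) := by
  have h := congrArg (genKinv K A d i * · * genKinv K A d i) (genF_mul_genK K A d i j)
  simpa only [mul_smul_comm, smul_mul_assoc, ← mul_assoc, genKinv_mul_genK, one_mul,
    mul_assoc _ (genK K A d i), genK_mul_genKinv, mul_one] using h

lemma genE_mul_genF_self (i : Fin n) :
    genE K A d i * genF K A d i = genF K A d i * genE K A d i +
      (qi K (d i) - (qi K (d i))⁻¹)⁻¹ • (genK K A d i - genKinv K A d i) := by
  have h := RingQuot.mkAlgHom_rel (Kq K) (CRel.R5 (K := K) (A := A) (d := d) i i)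
  rw [if_pos rfl] at h
  rw [← sub_eq_iff_eq_add']
  simpa only [genE, genF, genK, genKinv, map_sub, map_mul, map_smul] using h

lemma genE_mul_genF_of_ne {i j : Fin n} (hij : i ≠ j) :
    genE K A d i * genF K A d j = genF K A d j * genE K A d i := by
  have h := RingQuot.mkAlgHom_rel (Kq K) (CRel.R5 (K := K) (A := A) (d := d) i j)
  rw [if_neg hij, map_zero] at h
  rw [← sub_eq_zero]
  simpa only [genE, genF, map_sub, map_mul] using h

lemma serreSum_genE {i j : Fin n} (hij : i ≠ j) :
    serreSum K (d i) (1 - A i j).toNat (genE K A d i) (genE K A d j) = 0 := by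
  simpa only [serreSum, genE, map_sum, map_smul, map_mul, map_pow, map_zero] using
    RingQuot.mkAlgHom_rel (Kq K) (CRel.R6 (K := K) (A := A) (d := d) i j hij)

lemma serreSum_genF {i j : Fin n} (hij : i ≠ j) :
    serreSum K (d i) (1 - A i j).toNat (genF K A d i) (genF K A d j) = 0 := by
  simpa only [serreSum, genF, map_sum, map_smul, map_mul, map_pow, map_zero] using
    RingQuot.mkAlgHom_rel (Kq K) (CRel.R7 (K := K) (A := A) (d := d) i j hij)

variable {A d}

lemma qi_zpow_symm (hA : IsSymmetrizableGCM A d) (i j : Fin n) :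
    qi K (d j) ^ A j i = qi K (d i) ^ A i j := by
  obtain ⟨-, -, -, -, -, h⟩ := hA
  rw [qi, qi, ← zpow_natCast, ← zpow_natCast, ← zpow_mul, ← zpow_mul, h i j]

lemma qi_zpow_self (hA : IsSymmetrizableGCM A d) (i : Fin n) :
    qi K (d i) ^ A i i = qi K (d i) ^ 2 := by
  rw [hA.2.1 i]
  norm_cast

lemma hatY_mul_hatX (hA : IsSymmetrizableGCM A d) (i j : Fin n) :
    hatY K A d i * hatX K A d j - qi K (d i) ^ A i j • (hatX K A d j * hatY K A d i) =
      (1 - qi K (d i) ^ A i j) • (hatXinv K A d i * hatX K A d j) :=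
  add_smul_twisted_comm (by rw [genF_mul_genK, qi_zpow_symm K hA i j])
    (genKinv_genK_comm K A d i j) _

lemma hatX_mul_hatZ (i j : Fin n) :
    hatX K A d i * hatZ K A d j - qi K (d i) ^ A i j • (hatZ K A d j * hatX K A d i) =
      (1 - qi K (d i) ^ A i j) • (hatX K A d i * hatXinv K A d j) := by
  refine sub_smul_twisted_comm ?_ (genKinv_genK_comm K A d j i) _
  rw [← mul_assoc, ← genKinv_genK_comm, mul_assoc, genK_mul_genE, mul_smul_comm, mul_assoc]

lemma hatZ_mul_hatY_self (hA : IsSymmetrizableGCM A d) (i : Fin n) :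
    hatZ K A d i * hatY K A d i - qi K (d i) ^ 2 • (hatY K A d i * hatZ K A d i) =
      (1 - qi K (d i) ^ 2) • (1 : Uqg K A d) :=
  twisted_comm_self (qi_ne_zero_s4 K (d i)) (qi_sub_inv_ne_zero K (hA.2.2.2.1 i))
    (genKinv_mul_genK K A d i)
    ((genKinv_mul_genF K A d i i).trans (by rw [qi_zpow_self K hA]))
    ((genE_mul_genKinv K A d i i).trans (by rw [qi_zpow_self K hA]))
    (genE_mul_genF_self K A d i)

lemma hatZ_mul_hatY_of_ne (hA : IsSymmetrizableGCM A d) {i j : Fin n} (hij : i ≠ j) :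
    hatZ K A d i * hatY K A d j - qi K (d i) ^ A i j • (hatY K A d j * hatZ K A d i) =
      (1 - qi K (d i) ^ A i j) • (hatXinv K A d i * hatXinv K A d j) :=
  twisted_comm_of_comm (genKinv_mul_genF K A d i j)
    ((genE_mul_genKinv K A d j i).trans (by rw [qi_zpow_symm K hA i j]))
    (genE_mul_genF_of_ne K A d hij) (genKinv_comm K A d j i) _ _

lemma serreSum_hatY (hA : IsSymmetrizableGCM A d) {i j : Fin n} (hij : i ≠ j) :
    serreSum K (d i) (1 - A i j).toNat (hatY K A d i) (hatY K A d j) =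
      (∏ s ∈ Finset.range ((-(A i j)).toNat + 1), (1 - qi K (d i) ^ (A i j + 2 * (s : ℤ)))) •
        (hatXinv K A d i ^ (1 - A i j).toNat * hatXinv K A d j) := by
  have hd := hA.2.2.2.1 i
  have hq := qi_ne_zero_s4 K (d i)
  have hneg := hA.2.2.1 i j hij
  have hN : (1 - A i j).toNat = (-(A i j)).toNat + 1 := by omega
  have hN' : (((1 - A i j).toNat : ℕ) : ℤ) = 1 - A i j := by omega
  have hβ : qi K (d i) ^ A i j * qi K (d i) ^ (1 - A i j).toNat * (qi K (d i))⁻¹ = 1 := by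
    rw [← zpow_natCast, hN', ← zpow_add₀ hq, add_sub_cancel, zpow_one, mul_inv_cancel₀ hq]
  have hS := serreSum_smul_torus_mul K hd (α := 1) (β := 1) (κ := 1) (κ' := 1)
    (by simp) (by simp) (by simp) rfl (qi K (d i) - (qi K (d i))⁻¹) (qi K (d j) - (qi K (d j))⁻¹)
    (serreSum_genF K A d hij)
  simp only [one_mul] at hS
  have key := serreSum_add K hd (Or.inl rfl) hβ
    (κ := genKinv K A d i) (κ' := genKinv K A d j)
    (by simp only [mul_smul_comm, smul_mul_assoc, genKinv_mul_genF, qi_zpow_self K hA,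
          smul_comm (qi K (d i) ^ 2)])
    (by simp only [mul_smul_comm, smul_mul_assoc, genKinv_mul_genF, qi_zpow_symm K hA i j,
          smul_comm (qi K (d i) ^ A i j)])
    (by simp only [mul_smul_comm, smul_mul_assoc, genKinv_mul_genF,
          smul_comm (qi K (d i) ^ A i j)])
    (genKinv_comm K A d j i) hS
  refine key.trans ?_
  rw [hN, ← Finset.prod_range_reflect]
  congr 1
  refine Finset.prod_congr rfl fun s hs => ?_
  have hs' := Finset.mem_range.mp hs
  rw [← pow_mul, ← zpow_natCast, ← zpow_add₀ hq, ← zpow_neg]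
  congr 2
  push_cast
  omega

lemma serreSum_hatZ (hA : IsSymmetrizableGCM A d) {i j : Fin n} (hij : i ≠ j) :
    serreSum K (d i) (1 - A i j).toNat (hatZ K A d i) (hatZ K A d j) =
      (∏ s ∈ Finset.range ((-(A i j)).toNat + 1), (1 - qi K (d i) ^ (A i j + 2 * (s : ℤ)))) •
        (hatXinv K A d i ^ (1 - A i j).toNat * hatXinv K A d j) := by
  have hd := hA.2.2.2.1 i
  have hq := qi_ne_zero_s4 K (d i)
  have hneg := hA.2.2.1 i j hij
  have hN : (1 - A i j).toNat = (-(A i j)).toNat + 1 := by omega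
  have hN' : (((1 - A i j).toNat : ℕ) : ℤ) = 1 - A i j := by omega
  have hβ : (qi K (d i) ^ A i j)⁻¹ * (qi K (d i))⁻¹ ^ (1 - A i j).toNat * (qi K (d i))⁻¹⁻¹ = 1 := by
    rw [inv_pow, ← mul_inv, ← mul_inv, ← zpow_natCast, hN', ← zpow_add₀ hq, add_sub_cancel,
      zpow_one, mul_inv_cancel₀ hq, inv_one]
  have hE (a b : Fin n) : genKinv K A d a * genE K A d b =
      (qi K (d a) ^ A a b)⁻¹ • (genE K A d b * genKinv K A d a) := by
    rw [genE_mul_genKinv, smul_smul, inv_mul_cancel₀ (zpow_ne_zero _ (qi_ne_zero_s4 K _)), one_smul]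
  have hKE (a b : Fin n) (l : Kq K) :
      genKinv K A d a * (l • (genKinv K A d b * genE K A d b)) =
      (qi K (d a) ^ A a b)⁻¹ • (l • (genKinv K A d b * genE K A d b) * genKinv K A d a) := by
    rw [mul_smul_comm, smul_mul_assoc, smul_comm, ← mul_assoc, genKinv_comm, mul_assoc, hE,
      mul_smul_comm, mul_assoc]
  have hS := serreSum_smul_torus_mul K hd (genE_mul_genKinv K A d i i)
    ((genE_mul_genKinv K A d j i).trans (by rw [qi_zpow_symm K hA i j]))
    (genE_mul_genKinv K A d i j) (genKinv_comm K A d j i)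
    (-(qi K (d i) * (qi K (d i) - (qi K (d i))⁻¹)))
    (-(qi K (d j) * (qi K (d j) - (qi K (d j))⁻¹)))
    (serreSum_genE K A d hij)
  have key := serreSum_add K hd (Or.inr rfl) hβ
    ((hKE i i _).trans (by rw [qi_zpow_self K hA, inv_pow]))
    ((hKE j i _).trans (by rw [qi_zpow_symm K hA i j]))
    (hKE i j _) (genKinv_comm K A d j i) hS
  have hZ (a : Fin n) : hatZ K A d a = genKinv K A d a +
      (-(qi K (d a) * (qi K (d a) - (qi K (d a))⁻¹))) • (genKinv K A d a * genE K A d a) := by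
    exact sub_smul_eq_add_neg_smul (R := Uqg K A d) _ _ _
  rw [hZ i, hZ j]
  refine key.trans ?_
  rw [hN]
  congr 1
  refine Finset.prod_congr rfl fun s _ => ?_
  rw [inv_pow, inv_pow, ← mul_inv, inv_inv, ← pow_mul, ← zpow_natCast, ← zpow_add₀ hq]
  push_cast
  rfl

end ChevalleyRelations

/-- In `U_q(g)` the elements `X̂_i^{±1}, Ŷ_i, Ẑ_i` satisfy the equitable
relations (E1)–(E8); consequently there is an algebra homomorphism from the equitable
algebra `U` to `U_q(g)` sending `X_i^{±1} ↦ X̂_i^{±1}`, `Y_i ↦ Ŷ_i`, `Z_i ↦ Ẑ_i`. -/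
theorem hat_elements_satisfy_equitable_relations (hA : IsSymmetrizableGCM A d) :
    (∀ i, hatX K A d i * hatXinv K A d i = 1 ∧ hatXinv K A d i * hatX K A d i = 1) ∧
    (∀ i j, hatX K A d i * hatX K A d j = hatX K A d j * hatX K A d i) ∧
    (∀ i j, hatY K A d i * hatX K A d j -
        qi K (d i) ^ (A i j) • (hatX K A d j * hatY K A d i) =
      (1 - qi K (d i) ^ (A i j)) • (hatXinv K A d i * hatX K A d j)) ∧
    (∀ i j, hatX K A d i * hatZ K A d j -
        qi K (d i) ^ (A i j) • (hatZ K A d j * hatX K A d i) =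
      (1 - qi K (d i) ^ (A i j)) • (hatX K A d i * hatXinv K A d j)) ∧
    (∀ i, hatZ K A d i * hatY K A d i - (qi K (d i) ^ 2) • (hatY K A d i * hatZ K A d i) =
      (1 - qi K (d i) ^ 2) • (1 : Uqg K A d)) ∧
    (∀ i j, i ≠ j → hatZ K A d i * hatY K A d j -
        qi K (d i) ^ (A i j) • (hatY K A d j * hatZ K A d i) =
      (1 - qi K (d i) ^ (A i j)) • (hatXinv K A d i * hatXinv K A d j)) ∧
    (∀ i j, i ≠ j →
      ∑ r ∈ Finset.range ((1 - A i j).toNat + 1),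
        ((-1 : Kq K) ^ r * qbin K (d i) (1 - A i j).toNat r) •
          (hatY K A d i ^ ((1 - A i j).toNat - r) * hatY K A d j * hatY K A d i ^ r) =
      (∏ s ∈ Finset.range ((-(A i j)).toNat + 1), (1 - qi K (d i) ^ (A i j + 2 * (s : ℤ)))) •
        (hatXinv K A d i ^ (1 - A i j).toNat * hatXinv K A d j)) ∧
    (∀ i j, i ≠ j →
      ∑ r ∈ Finset.range ((1 - A i j).toNat + 1),
        ((-1 : Kq K) ^ r * qbin K (d i) (1 - A i j).toNat r) •
          (hatZ K A d i ^ ((1 - A i j).toNat - r) * hatZ K A d j * hatZ K A d i ^ r) =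
      (∏ s ∈ Finset.range ((-(A i j)).toNat + 1), (1 - qi K (d i) ^ (A i j + 2 * (s : ℤ)))) •
        (hatXinv K A d i ^ (1 - A i j).toNat * hatXinv K A d j)) ∧
    (∃ φ : Ueqg K A d →ₐ[Kq K] Uqg K A d, ∀ i,
      φ (genX K A d i) = hatX K A d i ∧ φ (genXinv K A d i) = hatXinv K A d i ∧
      φ (genY K A d i) = hatY K A d i ∧ φ (genZ K A d i) = hatZ K A d i) := by
  have h1 : ∀ i, hatX K A d i * hatXinv K A d i = 1 ∧ hatXinv K A d i * hatX K A d i = 1 :=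
    fun i => ⟨genK_mul_genKinv K A d i, genKinv_mul_genK K A d i⟩
  refine ⟨h1, genK_comm K A d, hatY_mul_hatX K hA, hatX_mul_hatZ K, hatZ_mul_hatY_self K hA,
    fun i j hij => hatZ_mul_hatY_of_ne K hA hij, fun i j hij => serreSum_hatY K hA hij,
    fun i j hij => serreSum_hatZ K hA hij, ?_⟩
  let g : EGen n → Uqg K A d := fun x => match x with
    | .X i => hatX K A d i
    | .Xinv i => hatXinv K A d i
    | .Y i => hatY K A d i
    | .Z i => hatZ K A d i
  have hg : ∀ ⦃x y⦄, ERel K A d x y → FreeAlgebra.lift (Kq K) g x = FreeAlgebra.lift (Kq K) g y := by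
    intro x y h
    induction h <;> simp only [map_mul, map_sub, map_smul, map_sum, map_pow, map_one,
      FreeAlgebra.lift_ι_apply, g]
    case E1a i => exact (h1 i).1
    case E1b i => exact (h1 i).2
    case E2 i j => exact genK_comm K A d i j
    case E3 i j => exact hatY_mul_hatX K hA i j
    case E4 i j => exact hatX_mul_hatZ K i j
    case E5 i => exact hatZ_mul_hatY_self K hA i
    case E6 i j hij => exact hatZ_mul_hatY_of_ne K hA hij
    case E7 i j hij => exact serreSum_hatY K hA hij
    case E8 i j hij => exact serreSum_hatZ K hA hij
  refine ⟨RingQuot.liftAlgHom (Kq K) ⟨FreeAlgebra.lift (Kq K) g, hg⟩, fun i => ?_⟩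
  simp [genX, genXinv, genY, genZ, g]

end Statement4
end
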